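/- (Main theorem, representation formula.) Suppose κ is a skewon-free invertible medium tensor on ℝ⁴ whose Fresnel polynomial has zero set equal to N(g₊) ∪ N(g₋) for two Lorentz metrics g₊, g₋ with N(g₊) ≠ N(g₋). Then there exist a Lorentz metric g, constants C₁ ∈ ℝ∖{0} and C₂ ∈ ℝ, a scalar ρ ∈ ℝ∖{0}, and a nonzero bivector A such that κ = C₁·∗_g + ρ(Ā⊗A) + C₂·Id and det κ ≠ (C₁² + C₂²)² · (C₂ + (1/2)·tr(ρ Ā⊗A))². -/

import Mathlib

noncomputable section
open Matrix BigOperators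

/-- Medium tensor components `κ^{ij}_{rs}` on ℝ⁴ (upper indices first). -/
abbrev MT := Fin 4 → Fin 4 → Fin 4 → Fin 4 → ℝ

/-- Bivector (or 2-form) components on ℝ⁴. -/
abbrev BV := Fin 4 → Fin 4 → ℝ

/-- Totally antisymmetric Levi-Civita symbol on {0,1,2,3} with ε₀₁₂₃ = 1. -/
def eps (i j k l : Fin 4) : ℝ :=
  ((j.val : ℝ) - i.val) * ((k.val : ℝ) - i.val) * ((l.val : ℝ) - i.val) *
    ((k.val : ℝ) - j.val) * ((l.val : ℝ) - j.val) * ((l.val : ℝ) - k.val) / 12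

/-- Identity medium tensor `Id^{ij}_{rs} = δ^i_r δ^j_s − δ^i_s δ^j_r`. -/
def idT : MT := fun i j r s =>
  (if i = r then (1 : ℝ) else 0) * (if j = s then 1 else 0) -
    (if i = s then 1 else 0) * (if j = r then 1 else 0)

/-- Composition `(κ∘η)^{ij}_{rs} = (1/2) κ^{ab}_{rs} η^{ij}_{ab}`. -/
def compT (κ η : MT) : MT := fun i j r s => (1 / 2) * ∑ a, ∑ b, κ a b r s * η i j a b

/-- Poincaré adjoint `κ̄^{ij}_{rs} = (1/4) ε_{rsab} κ^{ab}_{cd} ε^{cdij}`. -/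
def adjT (κ : MT) : MT := fun i j r s =>
  (1 / 4) * ∑ a, ∑ b, ∑ c, ∑ d, eps r s a b * κ a b c d * eps c d i j

/-- Trace `tr κ = (1/2) κ^{ij}_{ij}`. -/
def traceT (κ : MT) : ℝ := (1 / 2) * ∑ i, ∑ j, κ i j i j

def antisymBV (A : BV) : Prop := ∀ i j, A i j = - A j i

def antisymMT (κ : MT) : Prop :=
  (∀ i j r s, κ i j r s = - κ j i r s) ∧ (∀ i j r s, κ i j r s = - κ i j s r)

/-- The medium tensor `(ρ Ā⊗B)^{ij}_{rs} = ρ ε_{rsab} A^{ab} B^{ij}`. -/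
def tensAB (ρ : ℝ) (A B : BV) : MT := fun i j r s =>
  ρ * (∑ a, ∑ b, eps r s a b * A a b) * B i j

/-- Hodge star `(∗_g)^{ij}_{rs} = √|det g| g^{ia} g^{jb} ε_{abrs}`. -/
def hodge (g : Matrix (Fin 4) (Fin 4) ℝ) : MT := fun i j r s =>
  Real.sqrt |g.det| * ∑ a, ∑ b, g⁻¹ i a * g⁻¹ j b * eps a b r s

/-- The (non-symmetrised) Fresnel tensor density `𝒢₀^{ijkl}`. -/
def G0 (κ : MT) (i j k l : Fin 4) : ℝ :=
  (1 / 48) * ∑ a₁, ∑ a₂, ∑ a₃, ∑ a₄, ∑ b₁, ∑ b₂, ∑ b₃, ∑ b₄, ∑ b₅, ∑ b₆,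
    κ a₁ a₂ b₁ b₂ * κ a₃ i b₃ b₄ * κ a₄ j b₅ b₆ *
      eps b₁ b₂ b₅ k * eps b₃ b₄ b₆ l * eps a₁ a₂ a₃ a₄

/-- Fresnel polynomial `G(ξ) = 𝒢₀^{ijkl} ξ_i ξ_j ξ_k ξ_l`. -/
def fresnel (κ : MT) (ξ : Fin 4 → ℝ) : ℝ :=
  ∑ i, ∑ j, ∑ k, ∑ l, G0 κ i j k l * ξ i * ξ j * ξ k * ξ l

/-- A Lorentz metric: real symmetric invertible 4×4 matrix of signature
(−+++) or (+−−−), equivalently symmetric with negative determinant. -/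
def IsLorentz (g : Matrix (Fin 4) (Fin 4) ℝ) : Prop := g.IsSymm ∧ g.det < 0

/-- Null cone `N(g) = {ξ : g^{ij} ξ_i ξ_j = 0}` (on covectors, via the inverse metric). -/
def nullCone (g : Matrix (Fin 4) (Fin 4) ℝ) : Set (Fin 4 → ℝ) :=
  {ξ | ∑ i, ∑ j, g⁻¹ i j * ξ i * ξ j = 0}

/-- The ordering O = (01, 02, 03, 23, 31, 12) of index pairs. -/
def pairs : Fin 6 → Fin 4 × Fin 4 := ![(0, 1), (0, 2), (0, 3), (2, 3), (3, 1), (1, 2)]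

/-- The 6×6 matrix representing a medium tensor: `M_{IJ} = κ^{J₁J₂}_{I₁I₂}`. -/
def mat6 (κ : MT) : Matrix (Fin 6) (Fin 6) ℝ := fun I J =>
  κ (pairs J).1 (pairs J).2 (pairs I).1 (pairs I).2

/-- The Fresnel surface decomposes into a double light cone. -/
def DoubleCone (κ : MT) : Prop :=
  ∃ gp gm, IsLorentz gp ∧ IsLorentz gm ∧ nullCone gp ≠ nullCone gm ∧
    {ξ | fresnel κ ξ = 0} = nullCone gp ∪ nullCone gm

/-- The dual `U^{ijkl} = κ^{ij}_{rs} ε^{rskl}` of a medium tensor, with all indices upper. -/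
def raise (κ : MT) : MT := fun i j k l => ∑ r, ∑ s, κ i j r s * eps r s k l

/-- Components of a 4-index tensor with respect to the frame given by the columns of `N`. -/
def pull (N : Matrix (Fin 4) (Fin 4) ℝ) (U : MT) : MT := fun i j k l =>
  ∑ a, ∑ b, ∑ c, ∑ d, U a b c d * N a i * N b j * N c k * N d l

/-- The index symmetries of the raised form of a skewon-free medium tensor. -/
structure CurvSymm (U : MT) : Prop where
  fst : ∀ i j k l, U i j k l = - U j i k l
  snd : ∀ i j k l, U i j k l = - U i j l k
  swap : ∀ i j k l, U i j k l = U k l i j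

theorem sum_eps_mul (T : MT) :
    ∑ a, ∑ b, ∑ c, ∑ d, eps a b c d * T a b c d =
      T 0 1 2 3 - T 0 1 3 2 - T 0 2 1 3 + T 0 2 3 1 + T 0 3 1 2 - T 0 3 2 1
      - T 1 0 2 3 + T 1 0 3 2 + T 1 2 0 3 - T 1 2 3 0 - T 1 3 0 2 + T 1 3 2 0
      + T 2 0 1 3 - T 2 0 3 1 - T 2 1 0 3 + T 2 1 3 0 + T 2 3 0 1 - T 2 3 1 0
      - T 3 0 1 2 + T 3 0 2 1 + T 3 1 0 2 - T 3 1 2 0 - T 3 2 0 1 + T 3 2 1 0 := by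
  simp [Fin.sum_univ_four, eps]
  ring

theorem det_fin_four_rows (r : Fin 4 → Fin 4 → ℝ) :
    (Matrix.of r).det =
      ∑ a, ∑ b, ∑ c, ∑ d, eps a b c d * (r 0 a * r 1 b * r 2 c * r 3 d) := by
  rw [sum_eps_mul (fun a b c d => r 0 a * r 1 b * r 2 c * r 3 d)]
  simp [Matrix.det_succ_row_zero, Fin.sum_univ_succ, Fin.succAbove]
  ring

theorem sum_eps_mul_rows (N : Matrix (Fin 4) (Fin 4) ℝ) (a b c d : Fin 4) :
    ∑ i, ∑ j, ∑ k, ∑ l, eps i j k l * (N a i * N b j * N c k * N d l) =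
      N.det * eps a b c d := by
  have h1 := det_fin_four_rows (fun m => N (![a, b, c, d] m))
  have h2 := det_fin_four_rows (fun m => (1 : Matrix (Fin 4) (Fin 4) ℝ) (![a, b, c, d] m))
  have h3 : (Matrix.of fun m => N (![a, b, c, d] m)) =
      (Matrix.of fun m => (1 : Matrix (Fin 4) (Fin 4) ℝ) (![a, b, c, d] m)) * N := by
    ext i j
    simp [Matrix.mul_apply, Matrix.one_apply]
  rw [h3, Matrix.det_mul, h2] at h1
  simp only [Matrix.cons_val_zero, Matrix.cons_val_one, Matrix.cons_val] at h1
  rw [← h1, mul_comm]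
  congr 1
  simp only [Matrix.one_apply, mul_ite, mul_one, mul_zero, Finset.sum_ite_eq, Finset.mem_univ,
    if_true]
  rfl

theorem sum_four_comm (F : Fin 4 → Fin 4 → Fin 4 → Fin 4 → Fin 4 → Fin 4 → Fin 4 → Fin 4 → ℝ) :
    ∑ i, ∑ j, ∑ k, ∑ l, ∑ a, ∑ b, ∑ c, ∑ d, F i j k l a b c d =
      ∑ a, ∑ b, ∑ c, ∑ d, ∑ i, ∑ j, ∑ k, ∑ l, F i j k l a b c d := by
  have h (f : MT) : ∑ i, ∑ j, ∑ k, ∑ l, f i j k l =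
      ∑ p : Fin 4 × Fin 4 × Fin 4 × Fin 4, f p.1 p.2.1 p.2.2.1 p.2.2.2 := by
    simp only [Fintype.sum_prod_type]
  simp only [h]
  exact Finset.sum_comm

theorem sum_eps_mul_pull (N : Matrix (Fin 4) (Fin 4) ℝ) (T : MT) :
    ∑ i, ∑ j, ∑ k, ∑ l, eps i j k l * pull N T i j k l =
      N.det * ∑ a, ∑ b, ∑ c, ∑ d, eps a b c d * T a b c d := by
  simp only [pull, Finset.mul_sum]
  rw [sum_four_comm]
  refine Finset.sum_congr rfl fun a _ => Finset.sum_congr rfl fun b _ =>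
    Finset.sum_congr rfl fun c _ => Finset.sum_congr rfl fun d _ => ?_
  rw [← mul_assoc, ← sum_eps_mul_rows]
  simp only [Finset.sum_mul]
  refine Finset.sum_congr rfl fun i _ => Finset.sum_congr rfl fun j _ =>
    Finset.sum_congr rfl fun k _ => Finset.sum_congr rfl fun l _ => ?_
  ring

theorem sum_eps_mul_eps (p q r s : Fin 4) :
    ∑ a, ∑ b, eps a b p q * eps a b r s = 2 * idT p q r s := by
  let w (i j k l : Fin 4) : ℤ := ((j.val : ℤ) - i.val) * ((k.val : ℤ) - i.val) *
    ((l.val : ℤ) - i.val) * ((k.val : ℤ) - j.val) * ((l.val : ℤ) - j.val) * ((l.val : ℤ) - k.val)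
  have hw (i j k l : Fin 4) : eps i j k l = (w i j k l : ℝ) / 12 := by simp [eps, w]
  have h : ∀ p q r s : Fin 4, ∑ a, ∑ b, w a b p q * w a b r s =
      288 * ((if p = r then 1 else 0) * (if q = s then 1 else 0) -
        (if p = s then 1 else 0) * (if q = r then 1 else 0)) := by
    decide +kernel
  have h' := congrArg (Int.cast : ℤ → ℝ) (h p q r s)
  push_cast at h'
  have h2 : ∑ a, ∑ b, eps a b p q * eps a b r s =
      (1 / 144) * ∑ a, ∑ b, (w a b p q : ℝ) * w a b r s := by
    simp only [hw, Finset.mul_sum]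
    refine Finset.sum_congr rfl fun a _ => Finset.sum_congr rfl fun b _ => ?_
    ring
  rw [h2, h', idT]
  ring

theorem eps_swap_fst (i j k l : Fin 4) : eps i j k l = - eps j i k l := by
  unfold eps; ring

theorem eps_swap_snd (i j k l : Fin 4) : eps i j k l = - eps i j l k := by
  unfold eps; ring

theorem eps_pair_comm (i j k l : Fin 4) : eps i j k l = eps k l i j := by
  unfold eps; ring

theorem sum_mul_idT (f : BV) (hf : antisymBV f) (r s : Fin 4) :
    ∑ a, ∑ b, f a b * idT a b r s = 2 * f r s := by
  have h := hf r s
  simp only [idT, mul_sub, Finset.sum_sub_distrib, mul_ite, mul_one, mul_zero,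
    Finset.sum_ite_eq', Finset.mem_univ, if_true]
  linarith

theorem sum_sum_eps_eps (f : BV) (hf : antisymBV f) (r s : Fin 4) :
    ∑ a, ∑ b, (∑ c, ∑ d, f c d * eps c d a b) * eps a b r s = 4 * f r s := by
  have h2 (c d : Fin 4) : ∑ a, ∑ b, eps c d a b * eps a b r s = 2 * idT c d r s := by
    rw [← sum_eps_mul_eps]
    refine Finset.sum_congr rfl fun a _ => Finset.sum_congr rfl fun b _ => ?_
    rw [eps_pair_comm c d]
  calc _ = ∑ p : Fin 4 × Fin 4, ∑ q : Fin 4 × Fin 4,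
          f q.1 q.2 * eps q.1 q.2 p.1 p.2 * eps p.1 p.2 r s := by
        simp only [Fintype.sum_prod_type, Finset.sum_mul]
    _ = ∑ c, ∑ d, f c d * ∑ a, ∑ b, eps c d a b * eps a b r s := by
        rw [Finset.sum_comm]
        simp only [Fintype.sum_prod_type, Finset.mul_sum, mul_assoc]
    _ = 4 * f r s := by
        simp only [h2]
        rw [show 4 * f r s = 2 * (2 * f r s) by ring, ← sum_mul_idT f hf r s]
        simp only [Finset.mul_sum]
        refine Finset.sum_congr rfl fun a _ => Finset.sum_congr rfl fun b _ => ?_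
        ring

/-- A medium tensor is recovered from its raised form. -/
theorem sum_raise_mul_eps (κ : MT) (hκ : antisymMT κ) (i j r s : Fin 4) :
    ∑ a, ∑ b, raise κ i j a b * eps a b r s = 4 * κ i j r s :=
  sum_sum_eps_eps (κ i j) (hκ.2 i j) r s

theorem curvSymm_raise (κ : MT) (hκ : antisymMT κ) (hskew : adjT κ = κ) :
    CurvSymm (raise κ) := by
  have hfst (i j k l : Fin 4) : raise κ i j k l = - raise κ j i k l := by
    simp only [raise, hκ.1 i j, neg_mul, Finset.sum_neg_distrib]
  have hsnd (i j k l : Fin 4) : raise κ i j k l = - raise κ i j l k := by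
    simp only [raise, eps_swap_snd _ _ k l, mul_neg, Finset.sum_neg_distrib]
  have hadj (i j r s : Fin 4) :
      4 * κ i j r s = ∑ a, ∑ b, raise κ a b i j * eps a b r s := by
    conv_lhs => rw [← hskew]
    simp only [adjT, raise, Finset.sum_mul, Finset.mul_sum]
    refine Finset.sum_congr rfl fun a _ => Finset.sum_congr rfl fun b _ =>
      Finset.sum_congr rfl fun c _ => Finset.sum_congr rfl fun d _ => ?_
    rw [eps_pair_comm r s]
    ring
  refine ⟨hfst, hsnd, fun i j k l => ?_⟩
  have h1 : 4 * raise κ i j k l =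
      ∑ r, ∑ s, (∑ a, ∑ b, raise κ a b i j * eps a b r s) * eps r s k l := by
    simp only [← hadj]
    simp only [raise, Finset.mul_sum, mul_assoc]
  rw [sum_sum_eps_eps (fun a b => raise κ a b i j) (fun a b => hfst a b i j)] at h1
  linarith

theorem sum_pairs_comm (F : Fin 4 → Fin 4 → Fin 4 → Fin 4 → ℝ) :
    ∑ e, ∑ f, ∑ g, ∑ h, F e f g h = ∑ g, ∑ h, ∑ e, ∑ f, F e f g h := by
  simp only [← Fintype.sum_prod_type']
  exact Fintype.sum_equiv ⟨fun p => (p.2.2.1, p.2.2.2, p.1, p.2.1),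
    fun p => (p.2.2.1, p.2.2.2, p.1, p.2.1), fun _ => rfl, fun _ => rfl⟩ _ _ fun _ => rfl

theorem sum_six_contract (p q z : Fin 4 → Fin 4 → ℝ) (u v : Fin 4 → Fin 4 → Fin 4 → ℝ) (t : ℝ) :
    ∑ b₁, ∑ b₂, ∑ b₃, ∑ b₄, ∑ b₅, ∑ b₆,
      p b₁ b₂ * q b₃ b₄ * z b₅ b₆ * u b₁ b₂ b₅ * v b₃ b₄ b₆ * t =
    ∑ g, ∑ h, t * ((∑ r, ∑ s, p r s * u r s g) * (∑ r, ∑ s, q r s * v r s h) * z g h) := by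
  simp only [Finset.sum_mul, Finset.mul_sum]
  simp only [← Fintype.sum_prod_type']
  exact Fintype.sum_equiv ⟨fun x => (x.2.2.2.2.1, x.2.2.2.2.2, x.2.2.1, x.2.2.2.1, x.1, x.2.1),
    fun x => (x.2.2.2.2.1, x.2.2.2.2.2, x.2.2.1, x.2.2.2.1, x.1, x.2.1), fun _ => rfl,
    fun _ => rfl⟩ _ _ fun _ => by simp; ring

theorem sum_four_factor (x z ξ : Fin 4 → ℝ) (y : Fin 4 → Fin 4 → ℝ) (t : ℝ) :
    ∑ i, ∑ j, ∑ k, ∑ l, t * (x k * y i l * z j) * ξ i * ξ j * ξ k * ξ l =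
      t * ((∑ k, x k * ξ k) * (∑ i, ∑ l, y i l * ξ i * ξ l) * ∑ j, z j * ξ j) := by
  simp only [Finset.sum_mul, Finset.mul_sum]
  simp only [← Fintype.sum_prod_type']
  exact Fintype.sum_equiv ⟨fun x => (x.2.1, x.1, x.2.2.2, x.2.2.1),
    fun x => (x.2.1, x.1, x.2.2.2, x.2.2.1), fun _ => rfl, fun _ => rfl⟩ _ _
    fun _ => by simp; ring

theorem sum_four_six_comm (F : Fin 4 → Fin 4 → Fin 4 → Fin 4 → Fin 4 → Fin 4 → Fin 4 → Fin 4 →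
    Fin 4 → Fin 4 → ℝ) :
    ∑ i, ∑ j, ∑ k, ∑ l, ∑ a, ∑ b, ∑ c, ∑ d, ∑ g, ∑ h, F i j k l a b c d g h =
      ∑ a, ∑ b, ∑ c, ∑ d, ∑ g, ∑ h, ∑ i, ∑ j, ∑ k, ∑ l, F i j k l a b c d g h := by
  have h4 (f : MT) : ∑ i, ∑ j, ∑ k, ∑ l, f i j k l =
      ∑ p : Fin 4 × Fin 4 × Fin 4 × Fin 4, f p.1 p.2.1 p.2.2.1 p.2.2.2 := by
    simp only [Fintype.sum_prod_type]
  have h6 (f : Fin 4 → Fin 4 → MT) : ∑ a, ∑ b, ∑ c, ∑ d, ∑ g, ∑ h, f a b c d g h =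
      ∑ p : Fin 4 × Fin 4 × Fin 4 × Fin 4 × Fin 4 × Fin 4,
        f p.1 p.2.1 p.2.2.1 p.2.2.2.1 p.2.2.2.2.1 p.2.2.2.2.2 := by
    simp only [Fintype.sum_prod_type]
  rw [h6 fun a b c d g h => ∑ i, ∑ j, ∑ k, ∑ l, F i j k l a b c d g h]
  simp only [h6]
  rw [h4 fun i j k l => ∑ p : Fin 4 × Fin 4 × Fin 4 × Fin 4 × Fin 4 × Fin 4,
    F i j k l p.1 p.2.1 p.2.2.1 p.2.2.2.1 p.2.2.2.2.1 p.2.2.2.2.2, Finset.sum_comm]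
  refine Finset.sum_congr rfl fun p _ => ?_
  rw [h4 fun i j k l => F i j k l p.1 p.2.1 p.2.2.1 p.2.2.2.1 p.2.2.2.2.1 p.2.2.2.2.2]

theorem fresnel_eq_sum_raise (κ : MT) (ξ : Fin 4 → ℝ) :
    fresnel κ ξ = (1 / 48) * ∑ a, ∑ b, ∑ c, ∑ d, ∑ g, ∑ h,
      eps a b c d * ((∑ k, raise κ a b g k * ξ k) *
        (∑ i, ∑ l, raise κ c i h l * ξ i * ξ l) * ∑ j, κ d j g h * ξ j) := by
  have hG (i j k l : Fin 4) : G0 κ i j k l = (1 / 48) * ∑ a, ∑ b, ∑ c, ∑ d, ∑ g, ∑ h,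
      eps a b c d * (raise κ a b g k * raise κ c i h l * κ d j g h) := by
    rw [G0]
    congr 1
    exact Fintype.sum_congr _ _ fun a => Fintype.sum_congr _ _ fun b =>
      Fintype.sum_congr _ _ fun c => Fintype.sum_congr _ _ fun d =>
      sum_six_contract (κ a b) (κ c i) (κ d j) (fun r s g => eps r s g k)
        (fun r s h => eps r s h l) (eps a b c d)
  simp only [← sum_four_factor]
  rw [← sum_four_six_comm]
  simp only [fresnel, hG, Finset.mul_sum, Finset.sum_mul]
  simp only [mul_assoc]

theorem fresnel_eq_sum_eps (κ : MT) (hκ : antisymMT κ) (ξ : Fin 4 → ℝ) :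
    fresnel κ ξ = (1 / 192) * ∑ a, ∑ b, ∑ c, ∑ d, ∑ e, ∑ f, ∑ g, ∑ h,
      eps a b c d * (eps e f g h * ((∑ k, raise κ a b g k * ξ k) *
        (∑ i, ∑ l, raise κ c i h l * ξ i * ξ l) * (∑ j, raise κ d j e f * ξ j))) := by
  have hz (d g h : Fin 4) : ∑ j, κ d j g h * ξ j =
      (1 / 4) * ∑ e, ∑ f, (∑ j, raise κ d j e f * ξ j) * eps e f g h := by
    have hκ' (j : Fin 4) : κ d j g h = (1 / 4) * ∑ e, ∑ f, raise κ d j e f * eps e f g h := by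
      rw [sum_raise_mul_eps κ hκ]; ring
    simp only [hκ', Finset.mul_sum, Finset.sum_mul]
    rw [Finset.sum_comm]
    refine Fintype.sum_congr _ _ fun e => ?_
    rw [Finset.sum_comm]
    exact Fintype.sum_congr _ _ fun f => Fintype.sum_congr _ _ fun j => by ring
  have hc (t : ℝ) (y m : Fin 4 → ℝ) (z : BV) :
      ∑ e, ∑ f, ∑ g, ∑ h, t * (eps e f g h * (y g * m h * z e f)) =
        4 * ∑ g, ∑ h, t * (y g * m h * ((1 / 4) * ∑ e, ∑ f, z e f * eps e f g h)) := by
    rw [sum_pairs_comm]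
    simp only [Finset.mul_sum]
    exact Fintype.sum_congr _ _ fun g => Fintype.sum_congr _ _ fun h =>
      Fintype.sum_congr _ _ fun e => Fintype.sum_congr _ _ fun f => by ring
  rw [fresnel_eq_sum_raise]
  simp only [hz, hc]
  simp only [← Finset.mul_sum]
  ring

theorem pull_pull_prod (N : Matrix (Fin 4) (Fin 4) ℝ) (Y Z : Fin 4 → Fin 4 → Fin 4 → ℝ) (M : BV)
    (i j k l p q r s : Fin 4) :
    pull N (fun e f g h => pull N (fun a b c d => Y a b g * M c h * Z d e f) i j k l) p q r s =
      (∑ a, ∑ b, ∑ g, Y a b g * N a i * N b j * N g r) * (∑ c, ∑ h, M c h * N c k * N h s) *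
        ∑ d, ∑ e, ∑ f, Z d e f * N d l * N e p * N f q := by
  simp only [pull, Finset.sum_mul, Finset.mul_sum]
  simp only [← Fintype.sum_prod_type']
  exact Fintype.sum_equiv
    ⟨fun x => (x.2.2.2.2.2.2.2, x.1, x.2.1, x.2.2.2.2.2.2.1, x.2.2.2.1,
      x.2.2.2.2.1, x.2.2.2.2.2.1, x.2.2.1),
    fun x => (x.2.1, x.2.2.1, x.2.2.2.2.2.2.2, x.2.2.2.2.1, x.2.2.2.2.2.1, x.2.2.2.2.2.2.1,
      x.2.2.2.1, x.1), fun _ => rfl, fun _ => rfl⟩ _ _ fun _ => by simp; ring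

theorem det_sq_mul_sum_eps_eps (N : Matrix (Fin 4) (Fin 4) ℝ)
    (X : Fin 4 → Fin 4 → Fin 4 → Fin 4 → MT) :
    N.det ^ 2 * ∑ a, ∑ b, ∑ c, ∑ d, ∑ e, ∑ f, ∑ g, ∑ h,
      eps a b c d * (eps e f g h * X a b c d e f g h) =
    ∑ i, ∑ j, ∑ k, ∑ l, ∑ p, ∑ q, ∑ r, ∑ s, eps i j k l * (eps p q r s *
      pull N (fun e f g h => pull N (fun a b c d => X a b c d e f g h) i j k l) p q r s) := by
  simp only [← Finset.mul_sum]
  rw [pow_two, mul_assoc, ← sum_eps_mul_pull, Finset.mul_sum]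
  simp only [Finset.mul_sum (a := N.det)]
  refine Fintype.sum_congr _ _ fun i => Fintype.sum_congr _ _ fun j => Fintype.sum_congr _ _
    fun k => Fintype.sum_congr _ _ fun l => ?_
  rw [sum_eps_mul_pull, mul_left_comm]
  congr 2
  simp only [pull, Finset.sum_mul, Finset.mul_sum]
  rw [sum_four_comm]
  refine Fintype.sum_congr _ _ fun e => Fintype.sum_congr _ _ fun f => Fintype.sum_congr _ _
    fun g => Fintype.sum_congr _ _ fun h => Fintype.sum_congr _ _ fun a => Fintype.sum_congr _ _
    fun b => Fintype.sum_congr _ _ fun c => Fintype.sum_congr _ _ fun d => by ring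

theorem CurvSymm.pull {U : MT} (hU : CurvSymm U) (N : Matrix (Fin 4) (Fin 4) ℝ) :
    CurvSymm (pull N U) := by
  refine ⟨fun i j k l => ?_, fun i j k l => ?_, fun i j k l => ?_⟩
  · simp only [_root_.pull, ← Finset.sum_neg_distrib]
    rw [Finset.sum_comm]
    refine Fintype.sum_congr _ _ fun a => Fintype.sum_congr _ _ fun b => Fintype.sum_congr _ _
      fun c => Fintype.sum_congr _ _ fun d => ?_
    rw [hU.fst]; ring
  · simp only [_root_.pull, ← Finset.sum_neg_distrib]
    refine Fintype.sum_congr _ _ fun a => Fintype.sum_congr _ _ fun b => ?_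
    rw [Finset.sum_comm]
    refine Fintype.sum_congr _ _ fun c => Fintype.sum_congr _ _ fun d => ?_
    rw [hU.snd]; ring
  · simp only [_root_.pull]
    rw [sum_pairs_comm]
    refine Fintype.sum_congr _ _ fun a => Fintype.sum_congr _ _ fun b => Fintype.sum_congr _ _
      fun c => Fintype.sum_congr _ _ fun d => ?_
    rw [hU.swap]; ring

theorem sum_eps_eps_curv {V : MT} (hV : CurvSymm V) :
    ∑ i, ∑ j, ∑ k, ∑ l, ∑ p, ∑ q, ∑ r, ∑ s, eps i j k l * (eps p q r s *
      (V i j r 0 * V k 0 s 0 * V l 0 p q)) =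
    24 * (Matrix.of fun i k : Fin 3 => V 0 i.succ 0 k.succ).det := by
  simp only [← Finset.mul_sum]
  simp only [sum_eps_mul]
  have hd (i k l : Fin 4) : V i i k l = 0 := by linarith [hV.fst i i k l]
  have hd' (i k l : Fin 4) : V k l i i = 0 := by linarith [hV.snd k l i i]
  have e1 : ∀ k l, V 1 0 k l = - V 0 1 k l := hV.fst 1 0
  have e2 : ∀ k l, V 2 0 k l = - V 0 2 k l := hV.fst 2 0
  have e3 : ∀ k l, V 3 0 k l = - V 0 3 k l := hV.fst 3 0
  have f1 : ∀ k l, V k l 1 0 = - V k l 0 1 := fun k l => hV.snd k l 1 0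
  have f2 : ∀ k l, V k l 2 0 = - V k l 0 2 := fun k l => hV.snd k l 2 0
  have f3 : ∀ k l, V k l 3 0 = - V k l 0 3 := fun k l => hV.snd k l 3 0
  have g1 := hV.swap 0 2 0 1
  have g2 := hV.swap 0 3 0 1
  have g3 := hV.swap 0 3 0 2
  simp only [hd, hd', e1, e2, e3, f1, f2, f3, g1, g2, g3, Matrix.det_fin_three, Matrix.of_apply,
    Fin.succ_zero_eq_one, Fin.succ_one_eq_two, show (2 : Fin 3).succ = 3 from rfl]
  ring

/-- The Fresnel polynomial as a Gram determinant of the raised tensor on the bivectors divisible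
by the first vector of a frame. -/
theorem det_sq_mul_fresnel (κ : MT) (hκ : antisymMT κ) (hskew : adjT κ = κ)
    (N : Matrix (Fin 4) (Fin 4) ℝ) :
    N.det ^ 2 * fresnel κ (fun i => N i 0) =
      (1 / 8) * (Matrix.of fun i k : Fin 3 => pull N (raise κ) 0 i.succ 0 k.succ).det := by
  have h := sum_eps_eps_curv ((curvSymm_raise κ hκ hskew).pull N)
  have h2 := det_sq_mul_sum_eps_eps N fun a b c d e f g h =>
    (∑ k, raise κ a b g k * N k 0) * (∑ i, ∑ l, raise κ c i h l * N i 0 * N l 0) *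
      (∑ j, raise κ d j e f * N j 0)
  rw [fresnel_eq_sum_eps κ hκ, mul_left_comm, h2]
  have hY (i j r : Fin 4) : ∑ a, ∑ b, ∑ g, (∑ k, raise κ a b g k * N k 0) * N a i * N b j * N g r =
      pull N (raise κ) i j r 0 := by
    simp only [pull, Finset.sum_mul]
    exact Fintype.sum_congr _ _ fun a => Fintype.sum_congr _ _ fun b => Fintype.sum_congr _ _
      fun c => Fintype.sum_congr _ _ fun d => by ring
  have hM (k s : Fin 4) : ∑ c, ∑ h, (∑ i, ∑ l, raise κ c i h l * N i 0 * N l 0) * N c k * N h s =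
      pull N (raise κ) k 0 s 0 := by
    simp only [pull, Finset.sum_mul]
    refine Fintype.sum_congr _ _ fun a => ?_
    rw [Finset.sum_comm]
    exact Fintype.sum_congr _ _ fun b => Fintype.sum_congr _ _
      fun c => Fintype.sum_congr _ _ fun d => by ring
  have hZ (l p q : Fin 4) : ∑ d, ∑ e, ∑ f, (∑ j, raise κ d j e f * N j 0) * N d l * N e p * N f q =
      pull N (raise κ) l 0 p q := by
    simp only [pull, Finset.sum_mul]
    refine Fintype.sum_congr _ _ fun a => ?_
    rw [(Fintype.sum_congr _ _ fun e => Finset.sum_comm).trans Finset.sum_comm]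
    exact Fintype.sum_congr _ _ fun b => Fintype.sum_congr _ _
      fun c => Fintype.sum_congr _ _ fun d => by ring
  rw [show (1 / 8 : ℝ) = 1 / 192 * 24 by norm_num, mul_assoc, ← h]
  refine congrArg ((1 / 192 : ℝ) * ·) ?_
  refine Fintype.sum_congr _ _ fun i => Fintype.sum_congr _ _ fun j => Fintype.sum_congr _ _
    fun k => Fintype.sum_congr _ _ fun l => Fintype.sum_congr _ _ fun p => Fintype.sum_congr _ _
    fun q => Fintype.sum_congr _ _ fun r => Fintype.sum_congr _ _ fun s => ?_
  rw [pull_pull_prod N (fun a b g => ∑ k, raise κ a b g k * N k 0)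
    (fun d e f => ∑ j, raise κ d j e f * N j 0)
    (fun c h => ∑ i, ∑ l, raise κ c i h l * N i 0 * N l 0), hY, hM, hZ]

open scoped ContDiff in
/-- Analytic functions on a normed space form a domain. -/
theorem eq_zero_or_eq_zero_of_contDiff {𝕜 E : Type*} [RCLike 𝕜] [NormedAddCommGroup E]
    [NormedSpace 𝕜 E] {f g : E → 𝕜} (hf : ContDiff 𝕜 ω f) (hg : ContDiff 𝕜 ω g)
    (h : ∀ x, f x * g x = 0) : (∀ x, f x = 0) ∨ ∀ x, g x = 0 := by
  by_contra! hc
  obtain ⟨⟨p, hp⟩, q, hq⟩ := hc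
  have hl : ContDiff 𝕜 ω fun t : 𝕜 => p + t • (q - p) := by fun_prop
  have hf' := contDiff_omega_iff_analyticOnNhd.1 (hf.comp hl)
  have hg' := contDiff_omega_iff_analyticOnNhd.1 (hg.comp hl)
  rcases hf'.eq_zero_or_eq_zero_of_mul_eq_zero hg' (fun t _ => h _)
    isPreconnected_univ with h0 | h0
  · exact hp (by simpa using h0 0 trivial)
  · exact hq (by simpa using h0 1 trivial)

open scoped ContDiff in
theorem eq_zero_of_forall_ofReal {f : ℂ → ℂ} (hf : ContDiff ℂ ω f) (h : ∀ x : ℝ, f x = 0) (z : ℂ) :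
    f z = 0 := by
  refine (contDiff_omega_iff_analyticOnNhd.1 hf).eqOn_zero_of_preconnected_of_frequently_eq_zero
    isPreconnected_univ (Set.mem_univ 0) ?_ (Set.mem_univ z)
  have ht : Filter.Tendsto (fun x : ℝ => (x : ℂ)) (nhdsWithin 0 {0}ᶜ) (nhdsWithin 0 {0}ᶜ) := by
    refine tendsto_nhdsWithin_iff.2 ⟨?_, ?_⟩
    · exact (Complex.continuous_ofReal.tendsto' 0 0 (by simp)).mono_left nhdsWithin_le_nhds
    · filter_upwards [self_mem_nhdsWithin] with x hx
      simpa using hx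
  exact ht.frequently (Filter.Frequently.of_forall h)

open scoped ContDiff ComplexConjugate in
/-- An analytic function of two complex variables is determined by its restriction to the totally
real plane `{(z, conj z)}`. -/
theorem eq_zero_of_forall_conj {f : ℂ → ℂ → ℂ} (hf : ContDiff ℂ ω fun p : ℂ × ℂ => f p.1 p.2)
    (h : ∀ z, f z (conj z) = 0) (z w : ℂ) : f z w = 0 := by
  have h1 (x : ℝ) (v : ℂ) : f (x + v * Complex.I) (x - v * Complex.I) = 0 := by
    refine eq_zero_of_forall_ofReal (f := fun v => f (x + v * Complex.I) (x - v * Complex.I))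
      (hf.comp (f := fun v : ℂ => ((x : ℂ) + v * Complex.I, (x : ℂ) - v * Complex.I))
        (by fun_prop)) (fun y => ?_) v
    simpa [sub_eq_add_neg] using h (x + y * Complex.I)
  have h2 := eq_zero_of_forall_ofReal
    (f := fun u => f (u + (z - w) / (2 * Complex.I) * Complex.I)
      (u - (z - w) / (2 * Complex.I) * Complex.I))
    (hf.comp (f := fun u : ℂ => (u + (z - w) / (2 * Complex.I) * Complex.I,
      u - (z - w) / (2 * Complex.I) * Complex.I)) (by fun_prop)) (fun x => h1 x _) ((z + w) / 2)
  have e : (z - w) / (2 * Complex.I) * Complex.I = (z - w) / 2 := by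
    field_simp
  rw [e] at h2
  convert h2 using 1
  ring_nf

/-- A parametrisation of the null vectors of `ℂ³`. -/
def nullVec (z : ℂ) : Fin 3 → ℂ := ![1 - z ^ 2, Complex.I * (1 + z ^ 2), 2 * z]

/-- The complex conjugate of `nullVec (conj w)`. -/
def nullVecConj (w : ℂ) : Fin 3 → ℂ := ![1 - w ^ 2, -Complex.I * (1 + w ^ 2), 2 * w]

open scoped ComplexConjugate in
theorem conj_nullVec (z : ℂ) (i : Fin 3) : conj (nullVec z i) = nullVecConj (conj z) i := by
  fin_cases i <;> simp [nullVec, nullVecConj, Complex.conj_ofNat]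

open scoped ContDiff in
theorem contDiff_nullVec (i : Fin 3) : ContDiff ℂ ω fun z => nullVec z i := by
  fin_cases i <;> simp only [nullVec] <;> simp <;> fun_prop

open scoped ContDiff in
theorem contDiff_nullVecConj (i : Fin 3) : ContDiff ℂ ω fun z => nullVecConj z i := by
  fin_cases i <;> simp only [nullVecConj] <;> simp <;> fun_prop

/-- A symmetric matrix vanishing on all null vectors is scalar. -/
theorem eq_smul_one_of_nullVec {S : Matrix (Fin 3) (Fin 3) ℂ} (hS : S.IsSymm)
    (h : ∀ z, ∑ i, ∑ j, S i j * nullVec z i * nullVec z j = 0) :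
    ∃ μ : ℂ, ∀ i j, S i j = if i = j then μ else 0 := by
  have hI := Complex.I_sq
  have e1 := h 0
  have e2 := h 1
  have e3 := h (-1)
  have e4 := h Complex.I
  have e5 := h (-Complex.I)
  have s1 := hS.apply 0 1
  have s2 := hS.apply 0 2
  have s3 := hS.apply 1 2
  have hI4 : Complex.I ≠ 0 := Complex.I_ne_zero
  simp [Fin.sum_univ_three, nullVec, s1, s2, s3] at e1 e2 e3 e4 e5
  have h12 : S 1 2 = 0 := by
    have : Complex.I * S 1 2 = 0 := by linear_combination (e2 - e3) / 16
    simpa using this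
  have h02 : S 0 2 = 0 := by
    have : Complex.I * S 0 2 = 0 := by linear_combination (e4 - e5) / 16
    simpa using this
  have h22 : S 2 2 = S 1 1 := by linear_combination (e2 + e3) / 8 - S 1 1 * hI
  have h00 : S 0 0 = S 2 2 := by linear_combination (e4 + e5) / 8 - S 2 2 * hI
  have h01 : S 0 1 = 0 := by
    have : Complex.I * S 0 1 = 0 := by linear_combination (e1 - h00 - h22 - S 1 1 * hI) / 2
    simpa using this
  refine ⟨S 1 1, fun i j => ?_⟩
  fin_cases i <;> fin_cases j <;> simp [h12, h02, h22, h00, h01, s1, s2, s3]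

/-- A Hermitian-type form vanishing on all pairs of null vectors is zero. -/
theorem eq_zero_of_nullVec {H : Matrix (Fin 3) (Fin 3) ℂ}
    (h : ∀ z w, ∑ i, ∑ j, H i j * nullVecConj w i * nullVec z j = 0) : H = 0 := by
  have key (x : Fin 3 → ℂ) (hx : ∀ z, ∑ j, x j * nullVec z j = 0) : x = 0 := by
    have e1 := hx 0
    have e2 := hx 1
    have e3 := hx (-1)
    simp [Fin.sum_univ_three, nullVec] at e1 e2 e3
    have h2 : x 2 = 0 := by linear_combination (e2 - e3) / 4
    have h1 : x 1 = 0 := by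
      have : Complex.I * x 1 = 0 := by linear_combination (e2 + e3) / 4
      simpa using this
    have h0 : x 0 = 0 := by simpa [h1] using e1
    ext i
    fin_cases i <;> simp [h0, h1, h2]
  have key' (x : Fin 3 → ℂ) (hx : ∀ z, ∑ j, x j * nullVecConj z j = 0) : x = 0 := by
    have e1 := hx 0
    have e2 := hx 1
    have e3 := hx (-1)
    simp [Fin.sum_univ_three, nullVecConj] at e1 e2 e3
    have h2 : x 2 = 0 := by linear_combination (e2 - e3) / 4
    have h1 : x 1 = 0 := by
      have : Complex.I * x 1 = 0 := by linear_combination -(e2 + e3) / 4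
      simpa using this
    have h0 : x 0 = 0 := by simpa [h1] using e1
    ext i
    fin_cases i <;> simp [h0, h1, h2]
  have h1 (w : ℂ) := key (fun j => ∑ i, H i j * nullVecConj w i) fun z => by
    rw [← h z w, Finset.sum_comm]
    simp only [Finset.sum_mul]
  ext i j
  have h2 := key' (fun i => H i j) fun w => congrFun (h1 w) j
  exact congrFun h2 i

open scoped ComplexConjugate ContDiff in
theorem exists_spinor (S H : Matrix (Fin 3) (Fin 3) ℂ) (hS : S.IsSymm)
    (h : ∀ z, (∑ i, ∑ j, S i j * nullVec z i * nullVec z j) *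
      conj (∑ i, ∑ j, S i j * nullVec z i * nullVec z j) =
      (∑ i, ∑ j, H i j * conj (nullVec z i) * nullVec z j) ^ 2) :
    ∃ (a : Fin 3 → ℂ) (μ : ℂ) (σ : ℝ), (σ = 1 ∨ σ = -1) ∧
      (∀ i j, S i j = a i * a j + if i = j then μ else 0) ∧
      ∀ i j, H i j = σ * (conj (a i) * a j) := by
  have c1 := contDiff_nullVec
  have c2 := contDiff_nullVecConj
  set Ψ : ℂ → ℂ := fun z => ∑ i, ∑ j, S i j * nullVec z i * nullVec z j with hΨ
  set Ψc : ℂ → ℂ := fun w => ∑ i, ∑ j, conj (S i j) * nullVecConj w i * nullVecConj w j with hΨc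
  set η : ℂ → ℂ → ℂ := fun z w => ∑ i, ∑ j, H i j * nullVecConj w i * nullVec z j with hη
  have hconj (z : ℂ) : conj (Ψ z) = Ψc (conj z) := by
    simp only [hΨ, hΨc, map_sum, map_mul, conj_nullVec]
  have hconj' (z : ℂ) : Ψc z = conj (Ψ (conj z)) := by
    rw [hconj, Complex.conj_conj]
  have cη : ContDiff ℂ ω fun p : ℂ × ℂ => η p.1 p.2 := by
    refine ContDiff.sum fun i _ => ContDiff.sum fun j _ => ContDiff.mul (contDiff_const.mul ?_) ?_
    · exact (c2 i).comp contDiff_snd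
    · exact (c1 j).comp contDiff_fst
  have cΨ : ContDiff ℂ ω Ψ := by
    exact ContDiff.sum fun i _ => ContDiff.sum fun j _ => (contDiff_const.mul (c1 i)).mul (c1 j)
  have cΨc : ContDiff ℂ ω Ψc := by
    exact ContDiff.sum fun i _ => ContDiff.sum fun j _ => (contDiff_const.mul (c2 i)).mul (c2 j)
  have hpol (z w : ℂ) : Ψ z * Ψc w = η z w ^ 2 := by
    rw [← sub_eq_zero]
    refine eq_zero_of_forall_conj (f := fun z w => Ψ z * Ψc w - η z w ^ 2)
      (((cΨ.comp contDiff_fst).mul (cΨc.comp contDiff_snd)).sub (cη.pow 2)) (fun z => ?_) z w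
    rw [sub_eq_zero, ← hconj]
    simpa only [conj_nullVec] using h z
  by_cases hz : ∀ z, Ψ z = 0
  · obtain ⟨μ, hμ⟩ := eq_smul_one_of_nullVec hS hz
    have hH : H = 0 := eq_zero_of_nullVec fun z w => by
      have := hpol z w
      rw [hz, zero_mul] at this
      exact pow_eq_zero_iff two_ne_zero |>.1 this.symm
    exact ⟨0, μ, 1, Or.inl rfl, by simpa using hμ, by simp [hH]⟩
  · push Not at hz
    obtain ⟨z₀, hz₀⟩ := hz
    have hc0 : Ψc (conj z₀) ≠ 0 := by rw [← hconj]; simpa using hz₀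
    obtain ⟨c, hc⟩ := IsAlgClosed.exists_pow_nat_eq (Ψc (conj z₀)) two_pos
    have hcne : c ≠ 0 := by rintro rfl; simp at hc; exact hc0 hc.symm
    set a : Fin 3 → ℂ := fun j => (∑ i, H i j * nullVecConj (conj z₀) i) / c with ha
    have hηa (z : ℂ) : η z (conj z₀) = c * ∑ j, a j * nullVec z j := by
      simp only [hη, ha, Finset.mul_sum]
      rw [Finset.sum_comm]
      refine Fintype.sum_congr _ _ fun j => ?_
      rw [← Finset.sum_mul]
      field_simp
    have hΨa (z : ℂ) : Ψ z = (∑ j, a j * nullVec z j) ^ 2 := by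
      have := hpol z (conj z₀)
      rw [hηa, ← hc, mul_pow, mul_comm] at this
      exact mul_left_cancel₀ (pow_ne_zero 2 hcne) this
    have hΨca (w : ℂ) : Ψc w = (∑ j, conj (a j) * nullVecConj w j) ^ 2 := by
      rw [hconj', hΨa]
      simp only [map_pow, map_sum, map_mul, conj_nullVec, Complex.conj_conj]
    have hS' : ∃ μ : ℂ, ∀ i j, (S - Matrix.of fun i j => a i * a j) i j = if i = j then μ else 0 := by
      refine eq_smul_one_of_nullVec ?_ fun z => ?_
      · refine hS.sub ?_
        ext i j
        simp [mul_comm]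
      · have := hΨa z
        simp only [hΨ, pow_two, Finset.sum_mul_sum] at this
        simp only [Matrix.sub_apply, Matrix.of_apply, sub_mul, Finset.sum_sub_distrib, this]
        rw [sub_eq_zero]
        exact Fintype.sum_congr _ _ fun i => Fintype.sum_congr _ _ fun j => by ring
    obtain ⟨μ, hμ⟩ := hS'
    have ca : ContDiff ℂ ω fun p : ℂ × ℂ =>
        (∑ i, conj (a i) * nullVecConj p.2 i) * ∑ j, a j * nullVec p.1 j := by
      refine ContDiff.mul (ContDiff.sum fun i _ => contDiff_const.mul ?_)
        (ContDiff.sum fun i _ => contDiff_const.mul ?_)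
      · exact (c2 i).comp contDiff_snd
      · exact (c1 i).comp contDiff_fst
    have hH (τ : ℝ) (hτ : ∀ z w, η z w = τ * ((∑ i, conj (a i) * nullVecConj w i) *
        ∑ j, a j * nullVec z j)) (i j : Fin 3) : H i j = τ * (conj (a i) * a j) := by
      have : H - Matrix.of (fun i j => τ * (conj (a i) * a j)) = 0 :=
        eq_zero_of_nullVec fun z w => by
          have := hτ z w
          simp only [hη, Finset.sum_mul_sum] at this
          simp only [Finset.mul_sum] at this
          simp only [Matrix.sub_apply, Matrix.of_apply, sub_mul, Finset.sum_sub_distrib, this]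
          rw [sub_eq_zero]
          exact Fintype.sum_congr _ _ fun i => Fintype.sum_congr _ _ fun j => by ring
      exact congrFun (congrFun (sub_eq_zero.1 this) i) j
    have hS2 (i j : Fin 3) : S i j = a i * a j + if i = j then μ else 0 := by
      rw [← hμ i j]; simp
    rcases eq_zero_or_eq_zero_of_contDiff (cη.sub ca) (cη.add ca) (fun p => by
      have := hpol p.1 p.2
      rw [hΨa, hΨca] at this
      linear_combination -this) with h0 | h0
    · exact ⟨a, μ, 1, Or.inl rfl, hS2, hH 1 fun z w => by
        have := h0 (z, w)
        push_cast
        linear_combination this⟩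
    · exact ⟨a, μ, -1, Or.inr rfl, hS2, hH (-1) fun z w => by
        have := h0 (z, w)
        push_cast
        linear_combination this⟩

/-- The symmetric bilinear form on pairs `(E, B)` with blocks `X`, `Y`, `Z`. -/
def blockForm (X Y Z : Matrix (Fin 3) (Fin 3) ℝ) (E B E' B' : Fin 3 → ℝ) : ℝ :=
  ∑ i, ∑ j, (X i j * E i * E' j + Y i j * (E i * B' j + E' i * B j) + Z i j * B i * B' j)

/-- The real part of `nullVec (x + i y)`. -/
def nullRe (x y : ℝ) : Fin 3 → ℝ := ![1 - x ^ 2 + y ^ 2, -2 * x * y, 2 * x]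

/-- The imaginary part of `nullVec (x + i y)`. -/
def nullIm (x y : ℝ) : Fin 3 → ℝ := ![-2 * x * y, 1 + x ^ 2 - y ^ 2, 2 * y]

theorem nullVec_eq (z : ℂ) (i : Fin 3) :
    nullVec z i = nullRe z.re z.im i + nullIm z.re z.im i * Complex.I := by
  fin_cases i <;> apply Complex.ext <;> simp [nullVec, nullRe, nullIm, pow_two] <;> ring

section
open scoped ComplexConjugate

variable (X Y Z : Matrix (Fin 3) (Fin 3) ℝ)

theorem blockForm_selfDual (hX : X.IsSymm) (hZ : Z.IsSymm) (E B : Fin 3 → ℝ) :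
    ∑ i, ∑ j, ((((X i j - Z i j) / 2 : ℝ) : ℂ) - (((Y i j + Y j i) / 2 : ℝ) : ℂ) * Complex.I) *
        (E i + B i * Complex.I) * (E j + B j * Complex.I) =
      (((blockForm X Y Z E B E B - blockForm X Y Z B (-E) B (-E)) / 2 : ℝ) : ℂ) +
        ((blockForm X Y Z E B B (-E) : ℝ) : ℂ) * Complex.I := by
  have hx1 := hX.apply 0 1
  have hx2 := hX.apply 0 2
  have hx3 := hX.apply 1 2
  have hz1 := hZ.apply 0 1
  have hz2 := hZ.apply 0 2
  have hz3 := hZ.apply 1 2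
  apply Complex.ext <;>
  · simp [blockForm, Fin.sum_univ_three, hx1, hx2, hx3, hz1, hz2, hz3]
    ring

theorem blockForm_hermitian (hX : X.IsSymm) (hZ : Z.IsSymm) (E B : Fin 3 → ℝ) :
    ∑ i, ∑ j, ((((X i j + Z i j) / 2 : ℝ) : ℂ) + (((Y j i - Y i j) / 2 : ℝ) : ℂ) * Complex.I) *
        conj (E i + B i * Complex.I : ℂ) * (E j + B j * Complex.I) =
      (((blockForm X Y Z E B E B + blockForm X Y Z B (-E) B (-E)) / 2 : ℝ) : ℂ) := by
  have hx1 := hX.apply 0 1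
  have hx2 := hX.apply 0 2
  have hx3 := hX.apply 1 2
  have hz1 := hZ.apply 0 1
  have hz2 := hZ.apply 0 2
  have hz3 := hZ.apply 1 2
  apply Complex.ext <;>
  · simp [blockForm, Fin.sum_univ_three, hx1, hx2, hx3, hz1, hz2, hz3]
    ring

end

theorem exists_block_decomposition (X Y Z : Matrix (Fin 3) (Fin 3) ℝ) (hX : X.IsSymm)
    (hZ : Z.IsSymm)
    (h : ∀ x y, blockForm X Y Z (nullRe x y) (nullIm x y) (nullRe x y) (nullIm x y) *
        blockForm X Y Z (nullIm x y) (-nullRe x y) (nullIm x y) (-nullRe x y) =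
      blockForm X Y Z (nullRe x y) (nullIm x y) (nullIm x y) (-nullRe x y) ^ 2) :
    ∃ (s t ρ : ℝ) (e b : Fin 3 → ℝ), ρ ≠ 0 ∧
      (∀ i j, X i j = (if i = j then -s else 0) + ρ * (e i * e j)) ∧
      (∀ i j, Y i j = (if i = j then t else 0) + ρ * (e i * b j)) ∧
      ∀ i j, Z i j = (if i = j then s else 0) + ρ * (b i * b j) := by
  obtain ⟨a, μ, σ, hσ, hS, hH⟩ := exists_spinor
    (Matrix.of fun i j => (((X i j - Z i j) / 2 : ℝ) : ℂ) -
      (((Y i j + Y j i) / 2 : ℝ) : ℂ) * Complex.I)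
    (Matrix.of fun i j => (((X i j + Z i j) / 2 : ℝ) : ℂ) +
      (((Y j i - Y i j) / 2 : ℝ) : ℂ) * Complex.I)
    (by
      ext i j
      simp [hX.apply i j, hZ.apply i j, add_comm])
    (fun z => by
      simp only [nullVec_eq, Matrix.of_apply]
      rw [blockForm_selfDual X Y Z hX hZ, blockForm_hermitian X Y Z hX hZ, Complex.mul_conj,
        Complex.normSq_add_mul_I]
      have hz := h z.re z.im
      norm_cast
      linear_combination -hz)
  have hSre (i j : Fin 3) := congrArg Complex.re (hS i j)
  have hSim (i j : Fin 3) := congrArg Complex.im (hS i j)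
  have hHre (i j : Fin 3) := congrArg Complex.re (hH i j)
  have hHim (i j : Fin 3) := congrArg Complex.im (hH i j)
  simp [apply_ite] at hSre hSim hHre hHim
  rcases hσ with rfl | rfl
  · refine ⟨-μ.re, -μ.im, 2, fun i => (a i).re, fun i => -(a i).im, by norm_num,
      fun i j => ?_, fun i j => ?_, fun i j => ?_⟩
    · have h1 := hSre i j
      have h2 := hHre i j
      split_ifs at * <;> linarith
    · have h1 := hSim i j
      have h2 := hHim i j
      split_ifs at * <;> linarith
    · have h1 := hSre i j
      have h2 := hHre i j
      split_ifs at * <;> linarith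
  · refine ⟨-μ.re, -μ.im, -2, fun i => (a i).im, fun i => (a i).re, by norm_num,
      fun i j => ?_, fun i j => ?_, fun i j => ?_⟩
    · have h1 := hSre i j
      have h2 := hHre i j
      split_ifs at * <;> linarith
    · have h1 := hSim i j
      have h2 := hHim i j
      split_ifs at * <;> linarith
    · have h1 := hSre i j
      have h2 := hHre i j
      split_ifs at * <;> linarith

/-- The quadratic form `h^{ij} ξ_i ξ_j`. -/
def qf (h : Matrix (Fin 4) (Fin 4) ℝ) (ξ : Fin 4 → ℝ) : ℝ := ∑ i, ∑ j, h i j * ξ i * ξ j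

/-- The Minkowski metric. -/
def etaM : Matrix (Fin 4) (Fin 4) ℝ := Matrix.diagonal ![-1, 1, 1, 1]

theorem qf_etaM (ξ : Fin 4 → ℝ) :
    qf etaM ξ = -ξ 0 ^ 2 + ξ 1 ^ 2 + ξ 2 ^ 2 + ξ 3 ^ 2 := by
  simp [qf, etaM, Fin.sum_univ_four]
  ring

/-- A rational parametrisation of the Minkowski null cone. -/
def nullCov (x y : ℝ) : Fin 4 → ℝ := ![1 + x ^ 2 + y ^ 2, -2 * x, -2 * y, 1 - x ^ 2 - y ^ 2]

theorem qf_etaM_nullCov (x y : ℝ) : qf etaM (nullCov x y) = 0 := by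
  simp [qf_etaM, nullCov]
  ring

open scoped ContDiff in
theorem contDiff_qf (Q : Matrix (Fin 4) (Fin 4) ℝ) : ContDiff ℝ ω (qf Q) := by
  unfold qf
  fun_prop

open scoped ContDiff in
theorem contDiff_nullCov : ContDiff ℝ ω fun p : ℝ × ℝ => nullCov p.1 p.2 := by
  refine contDiff_pi.2 fun i => ?_
  fin_cases i <;> simp [nullCov] <;> fun_prop

theorem qf_eq_of_nullCov {Q : Matrix (Fin 4) (Fin 4) ℝ} (h : ∀ x y, qf Q (nullCov x y) = 0) :
    ∃ c, ∀ ξ, qf Q ξ = c * qf etaM ξ := by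
  have e1 := h 0 0
  have e2 := h 1 0
  have e3 := h (-1) 0
  have e4 := h 0 1
  have e5 := h 0 (-1)
  have e6 := h 2 0
  have e7 := h (-2) 0
  have e8 := h 0 2
  have e9 := h 0 (-2)
  have e10 := h 1 1
  simp [qf, nullCov, Fin.sum_univ_four] at e1 e2 e3 e4 e5 e6 e7 e8 e9 e10
  refine ⟨Q 1 1, fun ξ => ?_⟩
  have h01 : Q 0 1 + Q 1 0 = 0 := by linarith
  have h02 : Q 0 2 + Q 2 0 = 0 := by linarith
  have h00 : Q 0 0 = -Q 1 1 := by linarith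
  have h22 : Q 2 2 = Q 1 1 := by linarith
  have h13 : Q 1 3 + Q 3 1 = 0 := by linarith
  have h23 : Q 2 3 + Q 3 2 = 0 := by linarith
  have h03 : Q 0 3 + Q 3 0 = 0 := by linarith
  have h33 : Q 3 3 = Q 1 1 := by linarith
  have h12 : Q 1 2 + Q 2 1 = 0 := by linarith
  rw [qf_etaM]
  simp only [qf, Fin.sum_univ_four]
  linear_combination ξ 0 * ξ 1 * h01 + ξ 0 * ξ 2 * h02 + ξ 0 * ξ 3 * h03 + ξ 1 * ξ 2 * h12 +
    ξ 1 * ξ 3 * h13 + ξ 2 * ξ 3 * h23 + ξ 0 ^ 2 * h00 + ξ 2 ^ 2 * h22 + ξ 3 ^ 2 * h33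

theorem qf_mulVec (h P : Matrix (Fin 4) (Fin 4) ℝ) (ξ : Fin 4 → ℝ) :
    qf h (P *ᵥ ξ) = qf (Pᵀ * h * P) ξ := by
  have key (M : Matrix (Fin 4) (Fin 4) ℝ) (x : Fin 4 → ℝ) : qf M x = x ⬝ᵥ M *ᵥ x := by
    simp only [qf, dotProduct, Matrix.mulVec, Finset.mul_sum]
    exact Fintype.sum_congr _ _ fun i => Fintype.sum_congr _ _ fun j => by ring
  rw [key, key, ← Matrix.mulVec_mulVec, ← Matrix.mulVec_mulVec, Matrix.dotProduct_mulVec ξ Pᵀ,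
    Matrix.vecMul_transpose]

theorem qf_smul (c : ℝ) (h : Matrix (Fin 4) (Fin 4) ℝ) (ξ : Fin 4 → ℝ) :
    qf (c • h) ξ = c * qf h ξ := by
  simp only [qf, Matrix.smul_apply, smul_eq_mul, Finset.mul_sum, mul_assoc]

/-- A symmetric matrix is determined by its quadratic form. -/
theorem eq_of_qf_eq {Q R : Matrix (Fin 4) (Fin 4) ℝ} (hQ : Q.IsSymm) (hR : R.IsSymm)
    (h : ∀ ξ, qf Q ξ = qf R ξ) : Q = R := by
  have hs (M : Matrix (Fin 4) (Fin 4) ℝ) (i : Fin 4) : qf M (Pi.single i 1) = M i i := by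
    simp [qf, Pi.single_apply]
  have hp (M : Matrix (Fin 4) (Fin 4) ℝ) (i j : Fin 4) :
      qf M (Pi.single i 1 + Pi.single j 1) = M i i + M i j + M j i + M j j := by
    simp [qf, Pi.single_apply, mul_add, Finset.sum_add_distrib]
    ring
  ext i j
  have h1 := h (Pi.single i 1 + Pi.single j 1)
  have h2 := h (Pi.single i 1)
  have h3 := h (Pi.single j 1)
  rw [hp, hp] at h1
  rw [hs, hs] at h2 h3
  linarith [hQ.apply i j, hR.apply i j]

theorem exists_unique_sign {l : Fin 4 → ℝ} (h : ∏ i, l i < 0) :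
    ∃ (i₀ : Fin 4) (σ : ℝ), σ ^ 2 = 1 ∧ σ * l i₀ < 0 ∧ ∀ j ≠ i₀, 0 < σ * l j := by
  have key : ∀ s : Fin 4 → SignType, ∏ i, s i = -1 → ∃ (i₀ : Fin 4) (τ : SignType),
      (τ = 1 ∨ τ = -1) ∧ τ * s i₀ = -1 ∧ ∀ j ≠ i₀, τ * s j = 1 := by
    decide +kernel
  obtain ⟨i₀, τ, hτ, h0, hj⟩ := key (fun i => SignType.sign (l i)) (by
    rw [← sign_eq_neg_one_iff] at h
    rw [← h]
    exact (map_prod signHom l Finset.univ).symm)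
  rcases hτ with rfl | rfl
  · refine ⟨i₀, 1, by norm_num, ?_, fun j hji => ?_⟩
    · rw [one_mul, ← sign_eq_neg_one_iff]
      simpa using h0
    · rw [one_mul, ← sign_eq_one_iff]
      simpa using hj j hji
  · refine ⟨i₀, -1, by norm_num, ?_, fun j hji => ?_⟩
    · rw [neg_one_mul, Left.neg_neg_iff, ← sign_eq_one_iff]
      simpa using h0
    · rw [neg_one_mul, Left.neg_pos_iff, ← sign_eq_neg_one_iff]
      simpa [neg_eq_iff_eq_neg] using hj j hji

/-- A Lorentzian form is plus or minus the Minkowski form in a suitable frame. -/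
theorem exists_frame {h : Matrix (Fin 4) (Fin 4) ℝ} (hs : h.IsSymm) (hd : h.det < 0) :
    ∃ (P : Matrix (Fin 4) (Fin 4) ℝ) (σ : ℝ), P.det ≠ 0 ∧ σ ^ 2 = 1 ∧
      Pᵀ * h * P = σ • etaM := by
  have hh : h.IsHermitian := by
    rw [Matrix.IsHermitian, Matrix.conjTranspose_eq_transpose_of_trivial]; exact hs
  obtain ⟨i₀, σ, hσ, h0, hj⟩ := exists_unique_sign (l := hh.eigenvalues) (by
    have := hh.det_eq_prod_eigenvalues
    simp at this
    rwa [this] at hd)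
  set e := Equiv.swap 0 i₀
  set b := hh.eigenvectorBasis
  set d : Fin 4 → ℝ := fun i => (√|hh.eigenvalues i|)⁻¹ with hdef
  have hbb (i j : Fin 4) : ∑ a, b i a * b j a = if i = j then 1 else 0 := by
    have := orthonormal_iff_ite.1 b.orthonormal j i
    simp only [PiLp.inner_apply, RCLike.inner_apply, conj_trivial] at this
    rw [this]; simp [eq_comm]
  set P : Matrix (Fin 4) (Fin 4) ℝ := Matrix.of fun a k => d (e k) * b (e k) a with hP
  have hPh : Pᵀ * h * P = σ • etaM := by
    ext k l
    have hm : (h * P) = Matrix.of fun a l => d (e l) * (hh.eigenvalues (e l) * b (e l) a) := by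
      ext a l
      have := congrFun (hh.mulVec_eigenvectorBasis (e l)) a
      simp only [Matrix.mulVec, dotProduct, Pi.smul_apply, smul_eq_mul] at this
      simp only [hP, Matrix.mul_apply, Matrix.of_apply]
      rw [← this, Finset.mul_sum]
      exact Fintype.sum_congr _ _ fun i => by ring
    have h1 : (Pᵀ * h * P) k l = d (e k) * d (e l) * hh.eigenvalues (e l) *
        ∑ a, b (e k) a * b (e l) a := by
      rw [Matrix.mul_assoc, hm]
      simp only [hP, Matrix.mul_apply, Matrix.transpose_apply, Matrix.of_apply, Finset.mul_sum]
      exact Fintype.sum_congr _ _ fun i => by ring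
    rw [h1, hbb]
    simp only [Matrix.smul_apply, etaM, Matrix.diagonal_apply, smul_eq_mul, e.injective.eq_iff]
    split_ifs with hkl
    · subst hkl
      have hd2 (x : ℝ) (hx : x ≠ 0) : (√|x|)⁻¹ * (√|x|)⁻¹ * |x| = 1 := by
        rw [← mul_inv, Real.mul_self_sqrt (abs_nonneg x), inv_mul_cancel₀ (abs_ne_zero.2 hx)]
      have hk : hh.eigenvalues (e k) ≠ 0 ∧
          hh.eigenvalues (e k) = |hh.eigenvalues (e k)| * (σ * ![-1, 1, 1, 1] k) := by
        have hσ1 : |σ| = 1 := by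
          rw [← sq_eq_sq₀ (abs_nonneg σ) zero_le_one, sq_abs, hσ, one_pow]
        by_cases hk0 : k = 0
        · have h2 : σ * hh.eigenvalues (e k) < 0 := by simpa [hk0, e] using h0
          refine ⟨fun h3 => by simp [h3] at h2, ?_⟩
          have h3 := abs_of_neg h2
          rw [abs_mul, hσ1, one_mul] at h3
          have h4 : (![-1, 1, 1, 1] : Fin 4 → ℝ) k = -1 := by simp [hk0]
          rw [h4, h3]
          linear_combination -hh.eigenvalues (e k) * hσ
        · have h2 : 0 < σ * hh.eigenvalues (e k) := hj _ fun h3 => hk0 <| by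
            rw [← Equiv.swap_apply_left 0 i₀] at h3
            exact e.injective h3
          refine ⟨fun h3 => by simp [h3] at h2, ?_⟩
          have h3 := abs_of_pos h2
          rw [abs_mul, hσ1, one_mul] at h3
          have h4 : (![-1, 1, 1, 1] : Fin 4 → ℝ) k = 1 := by
            fin_cases k <;> simp at hk0 ⊢
          rw [h4, h3]
          linear_combination -hh.eigenvalues (e k) * hσ
      rw [mul_one, hk.2]
      linear_combination (σ * ![-1, 1, 1, 1] k) * hd2 _ hk.1
    · simp
  refine ⟨P, σ, fun h0 => ?_, hσ, hPh⟩
  have h4 := congrArg Matrix.det hPh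
  rw [Matrix.det_mul, h0, mul_zero, Matrix.det_smul, etaM, Matrix.det_diagonal] at h4
  simp [Fin.prod_univ_four] at h4
  rw [h4] at hσ
  norm_num at hσ

open scoped ContDiff in
theorem qf_eq_of_vanish_mul {h Q R : Matrix (Fin 4) (Fin 4) ℝ} (hs : h.IsSymm) (hd : h.det < 0)
    (hv : ∀ ξ, qf h ξ = 0 → qf Q ξ * qf R ξ = 0) :
    ∃ c, (∀ ξ, qf Q ξ = c * qf h ξ) ∨ ∀ ξ, qf R ξ = c * qf h ξ := by
  obtain ⟨P, σ, hP, hσ, hPh⟩ := exists_frame hs hd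
  have hback (S : Matrix (Fin 4) (Fin 4) ℝ) (hS : ∀ x y, qf S (P *ᵥ nullCov x y) = 0) :
      ∃ c, ∀ ξ, qf S ξ = c * qf h ξ := by
    simp only [qf_mulVec] at hS
    obtain ⟨c, hc⟩ := qf_eq_of_nullCov hS
    refine ⟨c * σ, fun ξ => ?_⟩
    have h1 := hc (P⁻¹ *ᵥ ξ)
    have h2 := qf_mulVec h P (P⁻¹ *ᵥ ξ)
    rw [hPh, qf_smul] at h2
    rw [← qf_mulVec] at h1
    rw [Matrix.mulVec_mulVec, Matrix.mul_nonsing_inv P (Ne.isUnit hP), Matrix.one_mulVec] at h1 h2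
    rw [h1, h2]
    linear_combination - c * qf etaM (P⁻¹ *ᵥ ξ) * hσ
  have c1 : ContDiff ℝ ω fun p : ℝ × ℝ => P *ᵥ nullCov p.1 p.2 := by
    refine contDiff_pi.2 fun i => ?_
    simp only [Matrix.mulVec, dotProduct]
    exact ContDiff.sum fun j _ => contDiff_const.mul (contDiff_pi.1 contDiff_nullCov j)
  rcases eq_zero_or_eq_zero_of_contDiff ((contDiff_qf Q).comp c1) ((contDiff_qf R).comp c1)
    (fun p => hv _ (by
      rw [qf_mulVec, hPh, qf_smul, qf_etaM_nullCov, mul_zero])) with h0 | h0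
  · obtain ⟨c, hc⟩ := hback Q fun x y => h0 (x, y)
    exact ⟨c, Or.inl hc⟩
  · obtain ⟨c, hc⟩ := hback R fun x y => h0 (x, y)
    exact ⟨c, Or.inr hc⟩

set_option maxRecDepth 10000 in
/-- A quartic form vanishing on the Minkowski null cone is divisible by the Minkowski form. -/
theorem exists_quartic_eq_mul {T : MT} {F : (Fin 4 → ℝ) → ℝ}
    (hF : ∀ ξ, F ξ = ∑ i, ∑ j, ∑ k, ∑ l, T i j k l * ξ i * ξ j * ξ k * ξ l)
    (h0 : ∀ ξ, qf etaM ξ = 0 → F ξ = 0) :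
    ∃ Q, ∀ ξ, F ξ = qf etaM ξ * qf Q ξ := by
  set c₁ : Fin 4 → ℝ := fun i => T 0 0 0 i + T 0 0 i 0 + T 0 i 0 0 + T i 0 0 0 with hc₁
  set c₂ : Fin 4 → Fin 4 → ℝ := fun i j => T 0 0 i j + T 0 i 0 j + T 0 i j 0 + T i 0 0 j +
    T i 0 j 0 + T i j 0 0 with hc₂
  set Q : Matrix (Fin 4) (Fin 4) ℝ := Matrix.of
    ![![-T 0 0 0 0, -c₁ 1, -c₁ 2, -c₁ 3],
      ![0, -c₂ 1 1 - T 0 0 0 0, -c₂ 1 2, -c₂ 1 3],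
      ![0, -c₂ 2 1, -c₂ 2 2 - T 0 0 0 0, -c₂ 2 3],
      ![0, -c₂ 3 1, -c₂ 3 2, -c₂ 3 3 - T 0 0 0 0]] with hQ
  refine ⟨Q, fun ξ => ?_⟩
  set r := √(ξ 1 ^ 2 + ξ 2 ^ 2 + ξ 3 ^ 2) with hr
  have hr2 : r ^ 2 = ξ 1 ^ 2 + ξ 2 ^ 2 + ξ 3 ^ 2 := Real.sq_sqrt (by positivity)
  set D : ℝ → ℝ := fun x => F ![x, ξ 1, ξ 2, ξ 3] -
    qf etaM ![x, ξ 1, ξ 2, ξ 3] * qf Q ![x, ξ 1, ξ 2, ξ 3] with hD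
  have key (x : ℝ) : D x = D 0 + x * (D 1 - D 0) := by
    simp only [hD, hF, qf_etaM]
    simp only [qf, Fin.sum_univ_four]
    simp only [Matrix.cons_val_zero, Matrix.cons_val_one, Matrix.cons_val]
    simp only [hQ, hc₁, hc₂, Matrix.of_apply, Matrix.cons_val_zero, Matrix.cons_val_one,
      Matrix.cons_val]
    ring
  have hroot (x : ℝ) (hx : x ^ 2 = r ^ 2) : D x = 0 := by
    have hx0 : qf etaM ![x, ξ 1, ξ 2, ξ 3] = 0 := by
      simp [qf_etaM, hx, hr2]
      ring
    simp only [hD, h0 _ hx0, hx0, zero_mul, sub_zero]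
  have h1 := hroot r rfl
  have h2 := hroot (-r) (by ring)
  rw [key] at h1 h2
  have h3 : ξ = ![ξ 0, ξ 1, ξ 2, ξ 3] := by
    ext i
    fin_cases i <;> rfl
  suffices D (ξ 0) = 0 by
    rw [h3]
    exact sub_eq_zero.1 this
  by_cases hr0 : r = 0
  · rw [hr0] at hr2
    have z1 : ξ 1 = 0 := by nlinarith [sq_nonneg (ξ 1), sq_nonneg (ξ 2), sq_nonneg (ξ 3)]
    have z2 : ξ 2 = 0 := by nlinarith [sq_nonneg (ξ 1), sq_nonneg (ξ 2), sq_nonneg (ξ 3)]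
    have z3 : ξ 3 = 0 := by nlinarith [sq_nonneg (ξ 1), sq_nonneg (ξ 2), sq_nonneg (ξ 3)]
    have hF0 : F ![ξ 0, 0, 0, 0] = T 0 0 0 0 * ξ 0 ^ 4 := by
      simp [hF, Fin.sum_univ_four]
      ring
    simp only [hD, qf_etaM]
    simp [hF0, qf, hQ, z1, z2, z3, Fin.sum_univ_four]
    ring
  · have h4 : D 1 - D 0 = 0 := by
      have : r * (D 1 - D 0) = 0 := by linarith
      simpa [hr0] using this
    rw [key, h4]
    linarith

theorem pull_mul (P N : Matrix (Fin 4) (Fin 4) ℝ) (U : MT) :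
    pull (P * N) U = pull N (pull P U) := by
  have h (u : ℝ) (x y z w : Fin 4 → ℝ) : u * (∑ e, x e) * (∑ f, y f) * (∑ g, z g) * ∑ h, w h =
      ∑ e, ∑ f, ∑ g, ∑ h, u * x e * y f * z g * w h := by
    simp only [← Finset.mul_sum, ← Finset.sum_mul]
  ext i j k l
  simp only [pull, Matrix.mul_apply, h]
  rw [sum_four_comm]
  simp only [Finset.sum_mul]
  refine Finset.sum_congr rfl fun a _ => Finset.sum_congr rfl fun b _ =>
    Finset.sum_congr rfl fun c _ => Finset.sum_congr rfl fun d _ =>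
    Finset.sum_congr rfl fun i _ => Finset.sum_congr rfl fun j _ =>
    Finset.sum_congr rfl fun k _ => Finset.sum_congr rfl fun l _ => ?_
  ring

/-- The frame whose first vector is `y` and whose other vectors are the standard ones. -/
def shear (y : Fin 4 → ℝ) : Matrix (Fin 4) (Fin 4) ℝ :=
  Matrix.of fun a i => if i = 0 then y a else if a = i then 1 else 0

theorem det_shear (y : Fin 4 → ℝ) : (shear y).det = y 0 := by
  simp [shear, Matrix.det_succ_row_zero, Fin.sum_univ_succ, Fin.succAbove]

/-- The Gram determinant of `V` on the bivectors `y ∧ e₁`, `y ∧ e₂`, `y ∧ e₃`. -/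
def gramDet (V : MT) (y : Fin 4 → ℝ) : ℝ :=
  (Matrix.of fun i k : Fin 3 => ∑ a, ∑ c, V a i.succ c k.succ * y a * y c).det

theorem gramDet_eq_pull_shear (V : MT) (y : Fin 4 → ℝ) :
    gramDet V y = (Matrix.of fun i k : Fin 3 => pull (shear y) V 0 i.succ 0 k.succ).det := by
  simp [gramDet, pull, shear]

/-- The linear coefficient of a determinant of quadratic polynomials. -/
theorem det_linear_coeff (m m' m'' : Fin 3 → Fin 3 → ℝ) (β γ q₀ q₁ q₂ : ℝ)
    (h : ∀ t : ℝ, (Matrix.of fun i j => m i j + t * m' i j + t ^ 2 * m'' i j).det =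
      (2 * t * β + t ^ 2 * γ) * (q₀ + t * q₁ + t ^ 2 * q₂)) :
    (Matrix.of ![m' 0, m 1, m 2]).det + (Matrix.of ![m 0, m' 1, m 2]).det +
      (Matrix.of ![m 0, m 1, m' 2]).det = 2 * β * q₀ := by
  have e1 := h 1
  have e2 := h (-1)
  have e3 := h 2
  have e4 := h (-2)
  have e5 := h 3
  have e6 := h (-3)
  simp [Matrix.det_fin_three] at *
  linear_combination (45 * (e1 - e2) - 9 * (e3 - e4) + (e5 - e6)) / 60

theorem qf_single_add_smul (M : Matrix (Fin 4) (Fin 4) ℝ) (k : Fin 4 → ℝ) (t : ℝ) :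
    qf M (Pi.single 0 1 + t • k) =
      M 0 0 + t * (∑ l, k l * (M l 0 + M 0 l)) + t ^ 2 * qf M k := by
  simp [qf, Fin.sum_univ_four]
  ring

/-- If a symmetric `3 × 3` matrix `m` is singular, the derivative of `det` at `m` in the
direction `n` is, up to a factor, the value of `n` on the last row of the adjugate of `m`. -/
theorem mul_sum_det_updateRow (m n : Fin 3 → Fin 3 → ℝ) (hm : ∀ i j, m i j = m j i)
    (hn : ∀ i j, n i j = n j i) (hdet : (Matrix.of m).det = 0) :
    (m 0 0 * m 1 1 - m 0 1 ^ 2) * ((Matrix.of ![n 0, m 1, m 2]).det +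
      (Matrix.of ![m 0, n 1, m 2]).det + (Matrix.of ![m 0, m 1, n 2]).det) =
    ∑ i, ∑ j, n i j *
      (![m 0 1 * m 1 2 - m 0 2 * m 1 1, m 0 2 * m 0 1 - m 0 0 * m 1 2,
        m 0 0 * m 1 1 - m 0 1 ^ 2] i *
      ![m 0 1 * m 1 2 - m 0 2 * m 1 1, m 0 2 * m 0 1 - m 0 0 * m 1 2,
        m 0 0 * m 1 1 - m 0 1 ^ 2] j) := by
  simp [Matrix.det_fin_three, Fin.sum_univ_three, hm 1 0, hm 2 0, hm 2 1, hn 1 0, hn 2 0,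
    hn 2 1] at hdet ⊢
  linear_combination (m 1 1 * n 0 0 + m 0 0 * n 1 1 - 2 * m 0 1 * n 0 1) * hdet

theorem degenerate_of_gramDet {W : MT} (hW : CurvSymm W) {h Q : Matrix (Fin 4) (Fin 4) ℝ}
    (hs : h.IsSymm) (hg : ∀ y, y 0 = 1 → gramDet W y = qf h y * qf Q y)
    (h00 : h 0 0 = 0) (h01 : h 0 1 = 0) (h02 : h 0 2 = 0) (h03 : h 0 3 ≠ 0) (hQ : Q 0 0 ≠ 0) :
    W 0 1 0 1 * W 0 2 0 2 = W 0 1 0 2 ^ 2 := by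
  set k : Fin 4 → ℝ := ![0, W 0 1 0 2 * W 0 2 0 3 - W 0 1 0 3 * W 0 2 0 2,
    W 0 1 0 3 * W 0 1 0 2 - W 0 1 0 1 * W 0 2 0 3, W 0 1 0 1 * W 0 2 0 2 - W 0 1 0 2 ^ 2] with hk
  have hdet : (Matrix.of fun i j : Fin 3 => W 0 i.succ 0 j.succ).det = 0 := by
    have := hg ![1, 0, 0, 0] rfl
    simpa [gramDet, qf, Fin.sum_univ_four, h00] using this
  have hβ : ∑ l, k l * (h l 0 + h 0 l) = 2 * (k 3 * h 0 3) := by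
    simp [Fin.sum_univ_four, h01, h02, hk, hs.apply 0 3, hs.apply 0 1, hs.apply 0 2]
    ring
  have hlin := det_linear_coeff (fun i j => W 0 i.succ 0 j.succ)
    (fun i j => ∑ l, k l * (W l i.succ 0 j.succ + W 0 i.succ l j.succ))
    (fun i j => ∑ a, ∑ c, W a i.succ c j.succ * k a * k c) (k 3 * h 0 3) (qf h k) (Q 0 0)
    (∑ l, k l * (Q l 0 + Q 0 l)) (qf Q k) fun t => by
      have := hg (Pi.single 0 1 + t • k) (by simp [hk])
      rw [qf_single_add_smul, qf_single_add_smul] at this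
      have hM (i j : Fin 3) := qf_single_add_smul (fun a c => W a i.succ c j.succ) k t
      simp only [qf] at hM
      simp only [gramDet, hM] at this
      rw [this, hβ, h00]
      ring
  have hanti (j : Fin 4) : ∑ i, ∑ l, k i * k l * W l i 0 j = 0 := by
    have : ∑ i, ∑ l, k i * k l * W l i 0 j = -∑ i, ∑ l, k i * k l * W l i 0 j := by
      conv_lhs => rw [Finset.sum_comm]
      simp only [← Finset.sum_neg_distrib]
      refine Finset.sum_congr rfl fun i _ => Finset.sum_congr rfl fun l _ => ?_
      rw [hW.fst i l]
      ring
    linarith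
  have hmul := mul_sum_det_updateRow _ (fun i j : Fin 3 =>
    ∑ l, k l * (W l i.succ 0 j.succ + W 0 i.succ l j.succ))
    (fun i j : Fin 3 => hW.swap 0 i.succ 0 j.succ)
    (fun i j => Finset.sum_congr rfl fun l _ => by
      rw [hW.swap l, hW.swap 0 i.succ]; ring) hdet
  rw [hlin] at hmul
  have hsum : ∑ i : Fin 3, ∑ j : Fin 3,
      (∑ l, k l * (W l i.succ 0 j.succ + W 0 i.succ l j.succ)) * (k i.succ * k j.succ) =
      2 * ∑ j, k j * ∑ i, ∑ l, k i * k l * W l i 0 j := by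
    have hk0 : k 0 = 0 := rfl
    have hsw (i j : Fin 3) : ∑ l, k l * (W l i.succ 0 j.succ + W 0 i.succ l j.succ) =
        ∑ l, k l * (W l i.succ 0 j.succ + W l j.succ 0 i.succ) :=
      Finset.sum_congr rfl fun l _ => by rw [hW.swap 0 i.succ l j.succ]
    simp only [hsw]
    simp only [Fin.sum_univ_three, Fin.sum_univ_four, hk0, Fin.succ_zero_eq_one,
      Fin.succ_one_eq_two, show (2 : Fin 3).succ = 3 from rfl]
    ring
  have h3 : k 3 ^ 2 * (h 0 3 * Q 0 0) = 0 := by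
    simp only [hanti, mul_zero, Finset.sum_const_zero] at hsum
    have hk' (i : Fin 3) : ![W 0 1 0 2 * W 0 2 0 3 - W 0 1 0 3 * W 0 2 0 2,
        W 0 1 0 3 * W 0 1 0 2 - W 0 1 0 1 * W 0 2 0 3, W 0 1 0 1 * W 0 2 0 2 - W 0 1 0 2 ^ 2] i =
        k i.succ := rfl
    have : k 3 * (2 * (k 3 * h 0 3) * Q 0 0) = 0 := hmul.trans ((Finset.sum_congr rfl fun i _ => Finset.sum_congr rfl fun j _ =>
      congrArg₂ (fun x y => _ * (x * y)) (hk' i) (hk' j)).trans hsum)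
    linear_combination this / 2
  simpa [hk, sub_eq_zero, h03, hQ] using h3

/-- The index pairs `23`, `31`, `12`. -/
def spacePair : Fin 3 → Fin 4 × Fin 4 := ![(2, 3), (3, 1), (1, 2)]

/-- The `01`, `02`, `03` components of `x ∧ y`. -/
def wedgeE (x y : Fin 4 → ℝ) (i : Fin 3) : ℝ := x 0 * y i.succ - x i.succ * y 0

/-- The `23`, `31`, `12` components of `x ∧ y`. -/
def wedgeB (x y : Fin 4 → ℝ) (i : Fin 3) : ℝ :=
  x (spacePair i).1 * y (spacePair i).2 - x (spacePair i).2 * y (spacePair i).1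

/-- The electric-electric block of a tensor. -/
def blockX (V : MT) : Matrix (Fin 3) (Fin 3) ℝ := Matrix.of fun i j => V 0 i.succ 0 j.succ

/-- The electric-magnetic block of a tensor. -/
def blockY (V : MT) : Matrix (Fin 3) (Fin 3) ℝ :=
  Matrix.of fun i j => V 0 i.succ (spacePair j).1 (spacePair j).2

/-- The magnetic-magnetic block of a tensor. -/
def blockZ (V : MT) : Matrix (Fin 3) (Fin 3) ℝ :=
  Matrix.of fun i j => V (spacePair i).1 (spacePair i).2 (spacePair j).1 (spacePair j).2

theorem sum_antisymm_mul {U : BV} (hU : ∀ i j, U i j = -U j i) (x y : Fin 4 → ℝ) :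
    ∑ a, ∑ b, U a b * x a * y b = ∑ i : Fin 3, (U 0 i.succ * wedgeE x y i +
      U (spacePair i).1 (spacePair i).2 * wedgeB x y i) := by
  have hd (i : Fin 4) : U i i = 0 := by linarith [hU i i]
  simp [Fin.sum_univ_four, Fin.sum_univ_three, wedgeE, wedgeB, spacePair, hd, hU 1 0, hU 2 0,
    hU 3 0, hU 2 1, hU 3 2, hU 1 3]
  ring

theorem sum_curv_mul {V : MT} (hV : CurvSymm V) (x y z w : Fin 4 → ℝ) :
    ∑ a, ∑ b, ∑ c, ∑ d, V a b c d * x a * y b * z c * w d =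
      blockForm (blockX V) (blockY V) (blockZ V) (wedgeE x y) (wedgeB x y) (wedgeE z w)
        (wedgeB z w) := by
  have h1 (a b : Fin 4) : ∑ c, ∑ d, V a b c d * x a * y b * z c * w d =
      (∑ c, ∑ d, V a b c d * z c * w d) * x a * y b := by
    simp only [Finset.sum_mul]
    exact Fintype.sum_congr _ _ fun c => Fintype.sum_congr _ _ fun d => by ring
  simp only [h1, sum_antisymm_mul (hV.snd _ _)]
  rw [sum_antisymm_mul (fun i j => by simp only [hV.fst i j, neg_mul, ← neg_add,
    Finset.sum_neg_distrib])]
  simp only [blockForm, Finset.sum_mul]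
  rw [← sub_eq_zero]
  simp only [← Finset.sum_add_distrib, ← Finset.sum_sub_distrib]
  have hs (i j : Fin 3) := hV.swap (spacePair i).1 (spacePair i).2 0 j.succ
  simp only [hs, blockX, blockY, blockZ, Matrix.of_apply, Fin.sum_univ_three]
  ring

theorem blockX_isSymm {V : MT} (hV : CurvSymm V) : (blockX V).IsSymm :=
  Matrix.IsSymm.ext fun _ _ => hV.swap _ _ _ _

theorem blockZ_isSymm {V : MT} (hV : CurvSymm V) : (blockZ V).IsSymm :=
  Matrix.IsSymm.ext fun _ _ => hV.swap _ _ _ _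

theorem blockForm_smul (X Y Z : Matrix (Fin 3) (Fin 3) ℝ) (c d : ℝ) (E B E' B' : Fin 3 → ℝ) :
    blockForm X Y Z (c • E) (c • B) (d • E') (d • B') = c * d * blockForm X Y Z E B E' B' := by
  simp only [blockForm, Finset.mul_sum, Pi.smul_apply, smul_eq_mul]
  exact Fintype.sum_congr _ _ fun i => Fintype.sum_congr _ _ fun j => by ring

/-- A frame adapted to the null covector `nullCov x y`: the first three vectors span its
orthogonal complement. -/
def nullFrame (x y : ℝ) : Matrix (Fin 4) (Fin 4) ℝ :=
  (Matrix.of ![nullCov x y, Fin.cons 0 (nullRe x y), Fin.cons 0 (nullIm x y), Pi.single 0 1])ᵀ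

theorem det_nullFrame_ne_zero (x y : ℝ) : (nullFrame x y).det ≠ 0 := by
  have h : (nullFrame x y).det = -(1 + x ^ 2 + y ^ 2) ^ 3 := by
    simp [nullFrame, nullCov, nullRe, nullIm, Matrix.det_succ_row_zero, Fin.sum_univ_succ,
      Fin.succAbove]
    ring
  rw [h]
  have : 0 < 1 + x ^ 2 + y ^ 2 := by positivity
  exact neg_ne_zero.2 (pow_pos this 3).ne'

theorem wedgeE_re (x y : ℝ) : wedgeE (nullCov x y) (Fin.cons 0 (nullRe x y)) =
    (1 + x ^ 2 + y ^ 2) • nullRe x y := by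
  ext i; fin_cases i <;> simp [wedgeE, nullCov, nullRe]

theorem wedgeE_im (x y : ℝ) : wedgeE (nullCov x y) (Fin.cons 0 (nullIm x y)) =
    (1 + x ^ 2 + y ^ 2) • nullIm x y := by
  ext i; fin_cases i <;> simp [wedgeE, nullCov, nullIm]

theorem wedgeB_re (x y : ℝ) : wedgeB (nullCov x y) (Fin.cons 0 (nullRe x y)) =
    (1 + x ^ 2 + y ^ 2) • nullIm x y := by
  ext i; fin_cases i <;> simp [wedgeB, spacePair, nullCov, nullIm, nullRe] <;> ring

theorem wedgeB_im (x y : ℝ) : wedgeB (nullCov x y) (Fin.cons 0 (nullIm x y)) =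
    (1 + x ^ 2 + y ^ 2) • -nullRe x y := by
  ext i; fin_cases i <;> simp [wedgeB, spacePair, nullCov, nullIm, nullRe] <;> ring

theorem transpose_mul_mul_apply (M N : Matrix (Fin 4) (Fin 4) ℝ) (i j : Fin 4) :
    (Nᵀ * M * N) i j = ∑ a, ∑ b, M a b * N a i * N b j := by
  simp only [Matrix.mul_apply, Matrix.transpose_apply, Finset.sum_mul]
  rw [Finset.sum_comm]
  exact Fintype.sum_congr _ _ fun i => Fintype.sum_congr _ _ fun j => by ring

theorem transpose_mul_etaM_mul_apply (N : Matrix (Fin 4) (Fin 4) ℝ) (i j : Fin 4) :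
    (Nᵀ * etaM * N) i j =
      -(N 0 i * N 0 j) + N 1 i * N 1 j + N 2 i * N 2 j + N 3 i * N 3 j := by
  simp [transpose_mul_mul_apply, etaM, Matrix.diagonal_apply, Fin.sum_univ_four]

/-- If the Gram determinants of `V` factor into two distinct quadratic forms, one of them
Minkowski, then the restriction of `V` to each null plane is degenerate. -/
theorem block_degenerate {V : MT} (hV : CurvSymm V) {h : Matrix (Fin 4) (Fin 4) ℝ}
    {F : (Fin 4 → ℝ) → ℝ}
    (hN : ∀ N : Matrix (Fin 4) (Fin 4) ℝ, N.det ^ 2 * F (fun i => N i 0) =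
      (Matrix.of fun i k : Fin 3 => pull N V 0 i.succ 0 k.succ).det)
    (hF : ∀ ξ, F ξ = qf etaM ξ * qf h ξ) (hh : ∃ x y, qf h (nullCov x y) ≠ 0) (x y : ℝ) :
    blockForm (blockX V) (blockY V) (blockZ V)
        (nullRe x y) (nullIm x y) (nullRe x y) (nullIm x y) *
      blockForm (blockX V) (blockY V) (blockZ V)
        (nullIm x y) (-nullRe x y) (nullIm x y) (-nullRe x y) =
      blockForm (blockX V) (blockY V) (blockZ V)
        (nullRe x y) (nullIm x y) (nullIm x y) (-nullRe x y) ^ 2 := by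
  set D : ℝ × ℝ → ℝ := fun p => blockForm (blockX V) (blockY V) (blockZ V)
        (nullRe p.1 p.2) (nullIm p.1 p.2) (nullRe p.1 p.2) (nullIm p.1 p.2) *
      blockForm (blockX V) (blockY V) (blockZ V)
        (nullIm p.1 p.2) (-nullRe p.1 p.2) (nullIm p.1 p.2) (-nullRe p.1 p.2) -
      blockForm (blockX V) (blockY V) (blockZ V)
        (nullRe p.1 p.2) (nullIm p.1 p.2) (nullIm p.1 p.2) (-nullRe p.1 p.2) ^ 2 with hD
  have hre (i : Fin 3) : ContDiff ℝ ⊤ fun p : ℝ × ℝ => nullRe p.1 p.2 i := by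
    fin_cases i <;> simp [nullRe] <;> fun_prop
  have him (i : Fin 3) : ContDiff ℝ ⊤ fun p : ℝ × ℝ => nullIm p.1 p.2 i := by
    fin_cases i <;> simp [nullIm] <;> fun_prop
  have hDc : ContDiff ℝ ⊤ D := by
    simp only [hD, blockForm, Pi.neg_apply]
    fun_prop
  have hprod (p : ℝ × ℝ) : qf h (nullCov p.1 p.2) * D p = 0 := by
    obtain ⟨x, y⟩ := p
    by_cases hq : qf h (nullCov x y) = 0
    · simp [hq]
    refine mul_eq_zero_of_right _ ?_
    set N := nullFrame x y with hNdef
    have hg (z : Fin 4 → ℝ) (hz : z 0 = 1) : gramDet (pull N V) z =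
        qf (Nᵀ * etaM * N) z * qf (N.det ^ 2 • (Nᵀ * h * N)) z := by
      have hcol : (fun i => (N * shear z) i 0) = N *ᵥ z := by
        ext i
        simp [Matrix.mul_apply, Matrix.mulVec, dotProduct, shear]
      rw [gramDet_eq_pull_shear, ← pull_mul, ← hN, hcol, hF, Matrix.det_mul, det_shear, hz,
        qf_smul, ← qf_mulVec, ← qf_mulVec]
      ring
    have hent (M : Matrix (Fin 4) (Fin 4) ℝ) : (Nᵀ * M * N) 0 0 = qf M (nullCov x y) :=
      transpose_mul_mul_apply M N 0 0
    have hW := degenerate_of_gramDet (hV.pull N) (h := Nᵀ * etaM * N)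
      (Matrix.IsSymm.ext fun i j => by simp only [transpose_mul_etaM_mul_apply]; ring) hg
      (by rw [hent, qf_etaM_nullCov])
      (by
        rw [transpose_mul_etaM_mul_apply]
        simp [hNdef, nullFrame, nullCov, nullRe]
        ring)
      (by
        rw [transpose_mul_etaM_mul_apply]
        simp [hNdef, nullFrame, nullCov, nullIm]
        ring)
      (by
        rw [transpose_mul_etaM_mul_apply]
        have hpos : 0 < 1 + x ^ 2 + y ^ 2 := by positivity
        simp [hNdef, nullFrame, nullCov]
        intro h0
        linarith)
      (by
        rw [Matrix.smul_apply, hent]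
        exact mul_ne_zero (pow_ne_zero 2 (det_nullFrame_ne_zero x y)) hq)
    have hp (i j : Fin 4) : pull N V 0 i 0 j = blockForm (blockX V) (blockY V) (blockZ V)
        (wedgeE (Nᵀ 0) (Nᵀ i)) (wedgeB (Nᵀ 0) (Nᵀ i)) (wedgeE (Nᵀ 0) (Nᵀ j))
        (wedgeB (Nᵀ 0) (Nᵀ j)) := sum_curv_mul hV _ _ _ _
    rw [hp, hp, hp, show Nᵀ 0 = nullCov x y from rfl,
      show Nᵀ 1 = Fin.cons 0 (nullRe x y) from rfl, show Nᵀ 2 = Fin.cons 0 (nullIm x y) from rfl,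
      wedgeE_re, wedgeE_im, wedgeB_re, wedgeB_im] at hW
    simp only [blockForm_smul] at hW
    have hpos : 0 < 1 + x ^ 2 + y ^ 2 := by positivity
    have hz : (1 + x ^ 2 + y ^ 2) ^ 4 * D (x, y) = 0 := by
      simp only [hD]
      linear_combination hW
    exact (mul_eq_zero.1 hz).resolve_left (pow_pos hpos 4).ne'
  rcases eq_zero_or_eq_zero_of_contDiff ((contDiff_qf h).comp contDiff_nullCov) hDc hprod
    with h0 | h0
  · obtain ⟨x, y, hxy⟩ := hh
    exact absurd (h0 (x, y)) hxy
  · exact sub_eq_zero.1 (h0 (x, y))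

theorem CurvSymm.ext_blocks {U V : MT} (hU : CurvSymm U) (hV : CurvSymm V)
    (hX : blockX U = blockX V) (hY : blockY U = blockY V) (hZ : blockZ U = blockZ V) : U = V := by
  have h (W : MT) (i j k l : Fin 4) : W i j k l = ∑ a, ∑ b, ∑ c, ∑ d, W a b c d *
      (Pi.single i 1 : Fin 4 → ℝ) a * (Pi.single j 1 : Fin 4 → ℝ) b *
      (Pi.single k 1 : Fin 4 → ℝ) c * (Pi.single l 1 : Fin 4 → ℝ) d := by
    simp [Pi.single_apply]
  ext i j k l
  rw [h U, h V, sum_curv_mul hU, sum_curv_mul hV, hX, hY, hZ]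

/-- The raised form of a sum of a Hodge star, a multiple of the identity and a rank one tensor. -/
def normalT (g : Matrix (Fin 4) (Fin 4) ℝ) (s t ρ : ℝ) (A : Matrix (Fin 4) (Fin 4) ℝ) : MT :=
  fun i j k l => s * (g i k * g j l - g i l * g j k) + t * eps i j k l + ρ * (A i j * A k l)

theorem curvSymm_normalT {g A : Matrix (Fin 4) (Fin 4) ℝ} (hg : g.IsSymm)
    (hA : ∀ i j, A i j = -A j i) (s t ρ : ℝ) : CurvSymm (normalT g s t ρ A) where
  fst i j k l := by
    simp only [normalT, hA i j, eps]
    ring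
  snd i j k l := by
    simp only [normalT, hA k l, eps]
    ring
  swap i j k l := by
    simp only [normalT, eps, hg.apply k i, hg.apply l j, hg.apply l i, hg.apply k j]
    ring

/-- The bivector with electric part `e` and magnetic part `b`. -/
def bivec (e b : Fin 3 → ℝ) : Matrix (Fin 4) (Fin 4) ℝ :=
  !![0, e 0, e 1, e 2; -e 0, 0, b 2, -b 1; -e 1, -b 2, 0, b 0; -e 2, b 1, -b 0, 0]

theorem bivec_antisymm (e b : Fin 3 → ℝ) (i j : Fin 4) : bivec e b i j = -bivec e b j i := by
  fin_cases i <;> fin_cases j <;> simp [bivec]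

theorem blockX_normalT (s t ρ : ℝ) (e b : Fin 3 → ℝ) (i j : Fin 3) :
    blockX (normalT etaM s t ρ (bivec e b)) i j = (if i = j then -s else 0) + ρ * (e i * e j) := by
  fin_cases i <;> fin_cases j <;> simp [blockX, normalT, etaM, bivec, eps]

theorem blockY_normalT (s t ρ : ℝ) (e b : Fin 3 → ℝ) (i j : Fin 3) :
    blockY (normalT etaM s t ρ (bivec e b)) i j = (if i = j then t else 0) + ρ * (e i * b j) := by
  fin_cases i <;> fin_cases j <;> simp [blockY, normalT, etaM, bivec, eps, spacePair] <;> norm_num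

theorem blockZ_normalT (s t ρ : ℝ) (e b : Fin 3 → ℝ) (i j : Fin 3) :
    blockZ (normalT etaM s t ρ (bivec e b)) i j = (if i = j then s else 0) + ρ * (b i * b j) := by
  fin_cases i <;> fin_cases j <;> simp [blockZ, normalT, etaM, bivec, eps, spacePair]

theorem qf_bivec (e b : Fin 3 → ℝ) (y : Fin 4 → ℝ) :
    qf (bivec e b * etaM * (bivec e b)ᵀ) y = qf etaM ((bivec e b)ᵀ *ᵥ y) := by
  rw [qf_mulVec, Matrix.transpose_transpose]

theorem gramDet_normalT (s t ρ : ℝ) (e b : Fin 3 → ℝ) (y : Fin 4 → ℝ) :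
    gramDet (normalT etaM s t ρ (bivec e b)) y =
      -y 0 ^ 2 * s ^ 2 * qf etaM y *
        qf (s • etaM + ρ • (bivec e b * etaM * (bivec e b)ᵀ)) y := by
  have hent (i k : Fin 3) : ∑ a, ∑ c,
      normalT etaM s t ρ (bivec e b) a i.succ c k.succ * y a * y c =
      s * (qf etaM y * (if i = k then 1 else 0) - y i.succ * y k.succ) +
        ρ * (((bivec e b)ᵀ *ᵥ y) i.succ * ((bivec e b)ᵀ *ᵥ y) k.succ) := by
    rw [qf_etaM]
    fin_cases i <;> fin_cases k <;>
    · simp [normalT, etaM, bivec, eps, Matrix.mulVec, dotProduct, Fin.sum_univ_four]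
      ring
  have hdot : ((bivec e b)ᵀ *ᵥ y) 0 * y 0 = -(((bivec e b)ᵀ *ᵥ y) 1 * y 1 +
      ((bivec e b)ᵀ *ᵥ y) 2 * y 2 + ((bivec e b)ᵀ *ᵥ y) 3 * y 3) := by
    simp [bivec, Matrix.mulVec, dotProduct, Fin.sum_univ_four]
    ring
  have hsplit : qf (s • etaM + ρ • (bivec e b * etaM * (bivec e b)ᵀ)) y =
      s * qf etaM y + ρ * qf etaM ((bivec e b)ᵀ *ᵥ y) := by
    rw [← qf_bivec, ← qf_smul, ← qf_smul]
    simp only [qf, Matrix.add_apply, add_mul, Finset.sum_add_distrib]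
  rw [hsplit, gramDet]
  simp only [hent]
  generalize (bivec e b)ᵀ *ᵥ y = α at *
  simp [qf_etaM, Matrix.det_fin_three]
  linear_combination ρ * s ^ 2 * (-y 0 ^ 2 + y 1 ^ 2 + y 2 ^ 2 + y 3 ^ 2) *
    (α 1 * y 1 + α 2 * y 2 + α 3 * y 3 - α 0 * y 0) * hdot

theorem det_smul_etaM_add_bivec (s ρ : ℝ) (e b : Fin 3 → ℝ) :
    (s • etaM + ρ • (bivec e b * etaM * (bivec e b)ᵀ)).det =
      -(s ^ 2 + ρ * s * ((b 0 ^ 2 + b 1 ^ 2 + b 2 ^ 2) - (e 0 ^ 2 + e 1 ^ 2 + e 2 ^ 2)) -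
        ρ ^ 2 * (e 0 * b 0 + e 1 * b 1 + e 2 * b 2) ^ 2) ^ 2 := by
  have hm : s • etaM + ρ • (bivec e b * etaM * (bivec e b)ᵀ) = Matrix.of ![
      ![-s + ρ * (e 0 ^ 2 + e 1 ^ 2 + e 2 ^ 2), ρ * (b 2 * e 1 - b 1 * e 2),
        ρ * (b 0 * e 2 - b 2 * e 0), ρ * (b 1 * e 0 - b 0 * e 1)],
      ![ρ * (b 2 * e 1 - b 1 * e 2), s + ρ * (-e 0 ^ 2 + b 2 ^ 2 + b 1 ^ 2),
        ρ * (-e 0 * e 1 - b 0 * b 1), ρ * (-e 0 * e 2 - b 0 * b 2)],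
      ![ρ * (b 0 * e 2 - b 2 * e 0), ρ * (-e 0 * e 1 - b 0 * b 1),
        s + ρ * (-e 1 ^ 2 + b 2 ^ 2 + b 0 ^ 2), ρ * (-e 1 * e 2 - b 1 * b 2)],
      ![ρ * (b 1 * e 0 - b 0 * e 1), ρ * (-e 0 * e 2 - b 0 * b 2),
        ρ * (-e 1 * e 2 - b 1 * b 2), s + ρ * (-e 2 ^ 2 + b 1 ^ 2 + b 0 ^ 2)]] := by
    have hK := transpose_mul_etaM_mul_apply (bivec e b)ᵀ
    simp only [Matrix.transpose_transpose, Matrix.transpose_apply] at hK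
    ext i j
    rw [Matrix.add_apply, Matrix.smul_apply, Matrix.smul_apply, hK]
    fin_cases i <;> fin_cases j <;> simp [bivec, etaM] <;> ring_nf <;> simp
  rw [hm]
  simp [Matrix.det_succ_row_zero, Fin.sum_univ_succ, Fin.succAbove]
  ring

theorem exists_normal_form {V : MT} (hV : CurvSymm V) {h : Matrix (Fin 4) (Fin 4) ℝ}
    (hs : h.IsSymm) (hd : h.det ≠ 0) {F : (Fin 4 → ℝ) → ℝ}
    (hN : ∀ N : Matrix (Fin 4) (Fin 4) ℝ, N.det ^ 2 * F (fun i => N i 0) =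
      (Matrix.of fun i k : Fin 3 => pull N V 0 i.succ 0 k.succ).det)
    (hF : ∀ ξ, F ξ = qf etaM ξ * qf h ξ) (hh : ∃ x y, qf h (nullCov x y) ≠ 0) :
    ∃ (s t ρ : ℝ) (e b : Fin 3 → ℝ), V = normalT etaM s t ρ (bivec e b) ∧ s ≠ 0 ∧ ρ ≠ 0 ∧
      bivec e b ≠ 0 ∧
      s ^ 2 + ρ * s * ((b 0 ^ 2 + b 1 ^ 2 + b 2 ^ 2) - (e 0 ^ 2 + e 1 ^ 2 + e 2 ^ 2)) -
        ρ ^ 2 * (e 0 * b 0 + e 1 * b 1 + e 2 * b 2) ^ 2 ≠ 0 := by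
  have heta : etaM.IsSymm := Matrix.isSymm_diagonal _
  obtain ⟨s, t, ρ, e, b, hρ, hX, hY, hZ⟩ := exists_block_decomposition _ _ _ (blockX_isSymm hV)
    (blockZ_isSymm hV) (block_degenerate hV hN hF hh)
  have hVn : V = normalT etaM s t ρ (bivec e b) :=
    hV.ext_blocks (curvSymm_normalT heta (bivec_antisymm e b) s t ρ)
      (by ext i j; rw [hX, blockX_normalT]) (by ext i j; rw [hY, blockY_normalT])
      (by ext i j; rw [hZ, blockZ_normalT])
  set R := s • etaM + ρ • (bivec e b * etaM * (bivec e b)ᵀ) with hR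
  have hRs : R.IsSymm := by
    refine (heta.smul s).add (Matrix.IsSymm.smul ?_ ρ)
    simp [Matrix.IsSymm, Matrix.transpose_mul, Matrix.mul_assoc, heta.eq]
  have hhR : h = -s ^ 2 • R := by
    refine eq_of_qf_eq hs (hRs.smul _) fun ξ => ?_
    have hS (ξ : Fin 4 → ℝ) : qf (h + s ^ 2 • R) ξ = qf h ξ + s ^ 2 * qf R ξ := by
      rw [← qf_smul]
      simp only [qf, Matrix.add_apply, add_mul, Finset.sum_add_distrib]
    have h0 (ξ : Fin 4 → ℝ) : (ξ 0 ^ 2 * qf etaM ξ) * qf (h + s ^ 2 • R) ξ = 0 := by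
      have := hN (shear ξ)
      rw [← gramDet_eq_pull_shear, hVn, gramDet_normalT, det_shear,
        show (fun i => shear ξ i 0) = ξ by ext i; simp [shear], hF, ← hR] at this
      rw [hS]
      linear_combination this
    rcases eq_zero_or_eq_zero_of_contDiff
      (((contDiff_apply ℝ ℝ (0 : Fin 4)).pow 2).mul (contDiff_qf etaM)) (contDiff_qf _) h0
      with h1 | h1
    · have := h1 (Pi.single 0 1)
      simp [qf_etaM] at this
    · have := h1 ξ
      rw [hS] at this
      rw [qf_smul]
      linear_combination this
  have hs0 : s ≠ 0 := by
    rintro rfl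
    apply hd
    simp [hhR]
  have hRd : R.det ≠ 0 := by
    intro hR0
    apply hd
    rw [hhR, Matrix.det_smul, hR0, mul_zero]
  refine ⟨s, t, ρ, e, b, hVn, hs0, hρ, ?_, ?_⟩
  · intro hb
    obtain ⟨x, y, hxy⟩ := hh
    apply hxy
    rw [hhR, hR, hb, qf_smul, Matrix.zero_mul, Matrix.zero_mul, smul_zero, add_zero, qf_smul,
      qf_etaM_nullCov, mul_zero, mul_zero]
  · intro hz
    apply hRd
    rw [hR, det_smul_etaM_add_bivec, hz]
    simp

theorem fresnel_mulVec (κ : MT) (P : Matrix (Fin 4) (Fin 4) ℝ) (ξ : Fin 4 → ℝ) :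
    fresnel κ (P *ᵥ ξ) =
      ∑ i, ∑ j, ∑ k, ∑ l, pull P (G0 κ) i j k l * ξ i * ξ j * ξ k * ξ l := by
  have h (u : ℝ) (x y z w : Fin 4 → ℝ) : u * (∑ e, x e) * (∑ f, y f) * (∑ g, z g) * ∑ h, w h =
      ∑ e, ∑ f, ∑ g, ∑ h, u * x e * y f * z g * w h := by
    simp only [← Finset.mul_sum, ← Finset.sum_mul]
  simp only [fresnel, Matrix.mulVec, dotProduct, h, pull]
  rw [sum_four_comm]
  simp only [Finset.sum_mul]
  refine Finset.sum_congr rfl fun a _ => Finset.sum_congr rfl fun b _ =>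
    Finset.sum_congr rfl fun c _ => Finset.sum_congr rfl fun d _ =>
    Finset.sum_congr rfl fun i _ => Finset.sum_congr rfl fun j _ =>
    Finset.sum_congr rfl fun k _ => Finset.sum_congr rfl fun l _ => ?_
  ring

theorem eq_zero_of_qf_eq_zero {h : Matrix (Fin 4) (Fin 4) ℝ} (hs : h.IsSymm)
    (h0 : ∀ ξ, qf h ξ = 0) : h = 0 :=
  eq_of_qf_eq hs Matrix.isSymm_zero fun ξ => (h0 ξ).trans (by simp [qf])

/-- A quartic form whose zero set is the union of the Minkowski null cone and the null cone of a
second Lorentz metric is, up to a factor, the product of the two quadratic forms. -/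
theorem exists_eq_mul_qf {T : MT} {F : (Fin 4 → ℝ) → ℝ} {h : Matrix (Fin 4) (Fin 4) ℝ}
    (hF : ∀ ξ, F ξ = ∑ i, ∑ j, ∑ k, ∑ l, T i j k l * ξ i * ξ j * ξ k * ξ l) (hs : h.IsSymm)
    (hd : h.det < 0) (hz : ∀ ξ, F ξ = 0 ↔ qf etaM ξ = 0 ∨ qf h ξ = 0)
    (hne : ¬ ∀ ξ, qf etaM ξ = 0 ↔ qf h ξ = 0) :
    ∃ c : ℝ, c ≠ 0 ∧ (∀ ξ, F ξ = qf etaM ξ * qf (c • h) ξ) ∧ ∃ x y, qf (c • h) (nullCov x y) ≠ 0 := by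
  have hh0 : h ≠ 0 := by
    rintro rfl
    simp at hd
  have heta : qf etaM (Pi.single 0 1) ≠ 0 := by simp [qf_etaM]
  obtain ⟨Q, hQ⟩ := exists_quartic_eq_mul hF fun ξ h0 => (hz ξ).2 (Or.inl h0)
  obtain ⟨c, hc | hc⟩ := qf_eq_of_vanish_mul (Q := etaM) (R := Q) hs hd fun ξ h0 => by
    rw [← hQ]
    exact (hz ξ).2 (Or.inr h0)
  · refine absurd (fun ξ => ?_) hne
    have hc0 : c ≠ 0 := by
      rintro rfl
      exact heta (by rw [hc, zero_mul])
    simp [hc, hc0]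
  have hF' (ξ : Fin 4 → ℝ) : F ξ = qf etaM ξ * qf (c • h) ξ := by rw [hQ, hc, qf_smul]
  have hc0 : c ≠ 0 := by
    rintro rfl
    rcases eq_zero_or_eq_zero_of_contDiff (contDiff_qf etaM) (contDiff_qf h) (fun ξ =>
      mul_eq_zero.2 ((hz ξ).1 (by simp [hQ, hc]))) with h0 | h0
    · exact heta (h0 _)
    · exact hh0 (eq_zero_of_qf_eq_zero hs h0)
  refine ⟨c, hc0, hF', ?_⟩
  by_contra! hall
  obtain ⟨c', hc'⟩ := qf_eq_of_nullCov hall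
  simp only [qf_smul] at hc'
  refine hne fun ξ => ?_
  have hc'0 : c' ≠ 0 := by
    rintro rfl
    exact hh0 (eq_zero_of_qf_eq_zero hs fun ξ => by simpa [hc0] using hc' ξ)
  simpa [hc0, hc'0] using Iff.of_eq (congrArg (· = 0) (hc' ξ)).symm

theorem exists_frame_normal_form {κ : MT} (hκ : antisymMT κ) (hskew : adjT κ = κ)
    {gp gm : Matrix (Fin 4) (Fin 4) ℝ} (hgp : IsLorentz gp) (hgm : IsLorentz gm)
    (hne : nullCone gp ≠ nullCone gm)
    (hF : {ξ | fresnel κ ξ = 0} = nullCone gp ∪ nullCone gm) :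
    ∃ (P : Matrix (Fin 4) (Fin 4) ℝ) (σ s t ρ : ℝ) (e b : Fin 3 → ℝ), P.det ≠ 0 ∧ σ ^ 2 = 1 ∧
      Pᵀ * gp⁻¹ * P = σ • etaM ∧ pull P (raise κ) = normalT etaM s t ρ (bivec e b) ∧
      s ≠ 0 ∧ ρ ≠ 0 ∧ bivec e b ≠ 0 ∧
      s ^ 2 + ρ * s * ((b 0 ^ 2 + b 1 ^ 2 + b 2 ^ 2) - (e 0 ^ 2 + e 1 ^ 2 + e 2 ^ 2)) -
        ρ ^ 2 * (e 0 * b 0 + e 1 * b 1 + e 2 * b 2) ^ 2 ≠ 0 := by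
  have hinv {g : Matrix (Fin 4) (Fin 4) ℝ} (hg : IsLorentz g) : g⁻¹.IsSymm ∧ g⁻¹.det < 0 := by
    refine ⟨?_, ?_⟩
    · rw [Matrix.IsSymm, Matrix.transpose_nonsing_inv, hg.1.eq]
    · rw [Matrix.det_nonsing_inv, Ring.inverse_eq_inv']
      exact inv_lt_zero.2 hg.2
  obtain ⟨P, σ, hP, hσ, hPg⟩ := exists_frame (hinv hgp).1 (hinv hgp).2
  have hσ0 : σ ≠ 0 := by
    rintro rfl
    norm_num at hσ
  have hPu : IsUnit P.det := hP.isUnit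
  set h := Pᵀ * gm⁻¹ * P with hh
  have hs : h.IsSymm := by
    simp [Matrix.IsSymm, hh, Matrix.transpose_mul, Matrix.mul_assoc, (hinv hgm).1.eq]
  have hd : h.det < 0 := by
    have : h.det = P.det ^ 2 * gm⁻¹.det := by
      rw [hh, Matrix.det_mul, Matrix.det_mul, Matrix.det_transpose]
      ring
    rw [this]
    exact mul_neg_of_pos_of_neg (by positivity) (hinv hgm).2
  have hcone (ξ : Fin 4 → ℝ) : (P *ᵥ ξ ∈ nullCone gp ↔ qf etaM ξ = 0) ∧
      (P *ᵥ ξ ∈ nullCone gm ↔ qf h ξ = 0) := by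
    refine ⟨?_, ?_⟩
    · change qf gp⁻¹ (P *ᵥ ξ) = 0 ↔ _
      rw [qf_mulVec, hPg, qf_smul]
      simp [hσ0]
    · change qf gm⁻¹ (P *ᵥ ξ) = 0 ↔ _
      rw [qf_mulVec]
  have hsurj (ξ : Fin 4 → ℝ) : P *ᵥ (P⁻¹ *ᵥ ξ) = ξ := by
    rw [Matrix.mulVec_mulVec, Matrix.mul_nonsing_inv P hPu, Matrix.one_mulVec]
  set k := 8 * P.det ^ 2 with hk
  have hk0 : k ≠ 0 := by positivity
  obtain ⟨c, hc, hFc, hnull⟩ := exists_eq_mul_qf (T := fun i j l m => k * pull P (G0 κ) i j l m)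
    (F := fun ξ => k * fresnel κ (P *ᵥ ξ))
    (fun ξ => by simp only [fresnel_mulVec, Finset.mul_sum, mul_assoc]) hs hd
    (fun ξ => by
      rw [← (hcone ξ).1, ← (hcone ξ).2, ← Set.mem_union, ← hF]
      simp [hk0])
    (fun hall => hne (by
      ext ξ
      rw [← hsurj ξ, (hcone _).1, (hcone _).2]
      exact hall _))
  obtain ⟨s, t, ρ, e, b, hV⟩ := exists_normal_form ((curvSymm_raise κ hκ hskew).pull P)
    (hs.smul c) (by
      rw [Matrix.det_smul]
      exact mul_ne_zero (pow_ne_zero _ hc) hd.ne)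
    (F := fun ξ => k * fresnel κ (P *ᵥ ξ))
    (fun N => by
      have := det_sq_mul_fresnel κ hκ hskew (P * N)
      rw [pull_mul, Matrix.det_mul] at this
      rw [show P *ᵥ (fun i => N i 0) = fun i => (P * N) i 0 from rfl]
      linear_combination 8 * this)
    hFc hnull
  exact ⟨P, σ, s, t, ρ, e, b, hP, hσ, hPg, hV⟩

theorem pull_one (U : MT) : pull 1 U = U := by
  ext i j k l
  simp [pull, Matrix.one_apply]

theorem pull_eps (N : Matrix (Fin 4) (Fin 4) ℝ) (i j k l : Fin 4) :
    pull N eps i j k l = N.det * eps i j k l := by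
  rw [← Matrix.det_transpose, ← sum_eps_mul_rows]
  simp only [pull, Matrix.transpose_apply]
  exact Fintype.sum_congr _ _ fun a => Fintype.sum_congr _ _ fun b => Fintype.sum_congr _ _
    fun c => Fintype.sum_congr _ _ fun d => by ring

theorem pull_normalT (N g A : Matrix (Fin 4) (Fin 4) ℝ) (s t ρ : ℝ) :
    pull N (normalT g s t ρ A) = normalT (Nᵀ * g * N) s (t * N.det) ρ (Nᵀ * A * N) := by
  have h2 (f g : Fin 4 → Fin 4 → ℝ) : (∑ a, ∑ b, f a b) * ∑ c, ∑ d, g c d =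
      ∑ a, ∑ b, ∑ c, ∑ d, f a b * g c d := by
    simp only [← Finset.mul_sum, ← Finset.sum_mul]
  have h3 (f g : Fin 4 → Fin 4 → ℝ) : (∑ a, ∑ c, f a c) * ∑ b, ∑ d, g b d =
      ∑ a, ∑ b, ∑ c, ∑ d, f a c * g b d := by
    rw [h2]
    exact Fintype.sum_congr _ _ fun a => Finset.sum_comm
  have h4 (f g : Fin 4 → Fin 4 → ℝ) : (∑ a, ∑ d, f a d) * ∑ b, ∑ c, g b c =
      ∑ a, ∑ b, ∑ c, ∑ d, f a d * g b c := by
    rw [h3]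
    exact Fintype.sum_congr _ _ fun a => Fintype.sum_congr _ _ fun b => Finset.sum_comm
  ext i j k l
  simp only [normalT, transpose_mul_mul_apply]
  rw [mul_assoc t, ← pull_eps, h3 (fun a c => g a c * N a i * N c k),
    h4 (fun a d => g a d * N a i * N d l), h2 (fun a b => A a b * N a i * N b j)]
  simp only [pull, normalT, Finset.mul_sum, ← Finset.sum_add_distrib, ← Finset.sum_sub_distrib]
  exact Fintype.sum_congr _ _ fun a => Fintype.sum_congr _ _ fun b => Fintype.sum_congr _ _
    fun c => Fintype.sum_congr _ _ fun d => by ring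

theorem sum_normalT_mul_eps (g A : Matrix (Fin 4) (Fin 4) ℝ) (s t ρ : ℝ) (i j r u : Fin 4) :
    ∑ a, ∑ b, normalT g s t ρ A i j a b * eps a b r u =
      2 * s * (∑ a, ∑ b, g i a * g j b * eps a b r u) + 2 * t * idT i j r u +
        ρ * (∑ a, ∑ b, eps r u a b * A a b) * A i j := by
  have h1 : ∑ a, ∑ b, g i b * g j a * eps a b r u = -∑ a, ∑ b, g i a * g j b * eps a b r u := by
    rw [Finset.sum_comm, ← Finset.sum_neg_distrib]
    refine Fintype.sum_congr _ _ fun a => ?_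
    rw [← Finset.sum_neg_distrib]
    exact Fintype.sum_congr _ _ fun b => by rw [eps_swap_fst]; ring
  have h2 : ∑ a, ∑ b, eps i j a b * eps a b r u = 2 * idT i j r u := by
    rw [← sum_eps_mul_eps]
    exact Fintype.sum_congr _ _ fun a => Fintype.sum_congr _ _ fun b => by
      rw [eps_pair_comm i j]
  have h3 (a b : Fin 4) : normalT g s t ρ A i j a b * eps a b r u =
      s * (g i a * g j b * eps a b r u) - s * (g i b * g j a * eps a b r u) +
        t * (eps i j a b * eps a b r u) + ρ * A i j * (eps r u a b * A a b) := by
    rw [eps_pair_comm r u]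
    simp only [normalT]
    ring
  simp only [h3, Finset.sum_add_distrib, Finset.sum_sub_distrib, ← Finset.mul_sum, h1, h2]
  ring

/-- The matrix of a 4-index tensor in the basis of index pairs `01, 02, 03, 23, 31, 12`. -/
def bivecMatrix (U : MT) : Matrix (Fin 3 ⊕ Fin 3) (Fin 3 ⊕ Fin 3) ℝ :=
  Matrix.of fun I J =>
    let p : Fin 3 ⊕ Fin 3 → Fin 4 × Fin 4 := Sum.elim (fun i => (0, i.succ)) spacePair
    U (p I).1 (p I).2 (p J).1 (p J).2

theorem CurvSymm.bivecMatrix_eq {U : MT} (hU : CurvSymm U) :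
    bivecMatrix U = fromBlocks (blockX U) (blockY U) (blockY U)ᵀ (blockZ U) := by
  ext (i | i) (j | j)
  · rfl
  · rfl
  · exact hU.swap _ _ 0 j.succ
  · rfl

theorem det_mat6 (κ : MT) : (mat6 κ).det = (bivecMatrix κ).det := by
  rw [← Matrix.det_transpose, ← Matrix.det_submatrix_equiv_self (finSumFinEquiv (m := 3) (n := 3))]
  refine congrArg _ ?_
  ext (i | i) (j | j) <;> fin_cases i <;> fin_cases j <;> rfl

theorem det_bivecMatrix_eps : (bivecMatrix eps).det = -1 := by
  have h : bivecMatrix eps = fromBlocks 0 1 1 0 := by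
    ext (i | i) (j | j) <;> fin_cases i <;> fin_cases j <;>
      simp [bivecMatrix, spacePair, eps] <;> norm_num
  have h2 : fromBlocks 1 1 0 1 * bivecMatrix eps =
      (fromBlocks 1 1 1 0 : Matrix (Fin 3 ⊕ Fin 3) (Fin 3 ⊕ Fin 3) ℝ) := by
    rw [h, fromBlocks_multiply]
    simp
  have h3 := congrArg Matrix.det h2
  rw [det_mul, det_fromBlocks_zero₂₁, det_fromBlocks_one₁₁] at h3
  simpa [det_neg, pow_succ] using h3

theorem det_bivecMatrix_raise (κ : MT) (hκ : antisymMT κ) :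
    (bivecMatrix (raise κ)).det = -64 * (mat6 κ).det := by
  have h : bivecMatrix (raise κ) = (2 : ℝ) • (bivecMatrix κ * bivecMatrix eps) := by
    ext I J
    simp only [bivecMatrix, raise, Matrix.of_apply, Matrix.smul_apply, Matrix.mul_apply,
      Fintype.sum_sum_type, Sum.elim_inl, Sum.elim_inr]
    generalize Sum.elim (fun i : Fin 3 => ((0 : Fin 4), i.succ)) spacePair I = p
    generalize Sum.elim (fun i : Fin 3 => ((0 : Fin 4), i.succ)) spacePair J = q
    have hd (i : Fin 4) : κ p.1 p.2 i i = 0 := by linarith [hκ.2 p.1 p.2 i i]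
    have h1 := hκ.2 p.1 p.2
    simp [Fin.sum_univ_four, Fin.sum_univ_three, spacePair, hd, h1 1 0, h1 2 0, h1 3 0, h1 2 1,
      h1 3 2, h1 1 3, eps_swap_fst 1 0, eps_swap_fst 2 0, eps_swap_fst 3 0, eps_swap_fst 2 1,
      eps_swap_fst 3 2, eps_swap_fst 1 3]
    ring
  rw [h, det_smul, det_mul, det_bivecMatrix_eps, det_mat6]
  norm_num

/-- The second exterior power of a matrix. -/
def wedgeMatrix (N : Matrix (Fin 4) (Fin 4) ℝ) : Matrix (Fin 3 ⊕ Fin 3) (Fin 3 ⊕ Fin 3) ℝ :=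
  Matrix.of fun R J =>
    let p : Fin 3 ⊕ Fin 3 → Fin 4 × Fin 4 := Sum.elim (fun i => (0, i.succ)) spacePair
    Sum.elim (wedgeE (Nᵀ (p J).1) (Nᵀ (p J).2)) (wedgeB (Nᵀ (p J).1) (Nᵀ (p J).2)) R

theorem bivecMatrix_pull {U : MT} (hU : CurvSymm U) (N : Matrix (Fin 4) (Fin 4) ℝ) :
    bivecMatrix (pull N U) = (wedgeMatrix N)ᵀ * bivecMatrix U * wedgeMatrix N := by
  rw [hU.bivecMatrix_eq]
  ext I J
  have h := sum_curv_mul hU (Nᵀ (Sum.elim (fun i => ((0 : Fin 4), i.succ)) spacePair I).1)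
    (Nᵀ (Sum.elim (fun i => ((0 : Fin 4), i.succ)) spacePair I).2)
    (Nᵀ (Sum.elim (fun i => ((0 : Fin 4), i.succ)) spacePair J).1)
    (Nᵀ (Sum.elim (fun i => ((0 : Fin 4), i.succ)) spacePair J).2)
  refine Eq.trans h ?_
  simp only [blockForm, Matrix.mul_apply, Fintype.sum_sum_type, Fin.sum_univ_three,
    wedgeMatrix, Matrix.transpose_apply, Matrix.of_apply, Sum.elim_inl, Sum.elim_inr,
    fromBlocks_apply₁₁, fromBlocks_apply₁₂, fromBlocks_apply₂₁, fromBlocks_apply₂₂]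
  ring

theorem normalT_smul {σ : ℝ} (hσ : σ ^ 2 = 1) (g A : Matrix (Fin 4) (Fin 4) ℝ) (s t ρ : ℝ) :
    normalT (σ • g) s t ρ A = normalT g s t ρ A := by
  ext i j k l
  simp only [normalT, Matrix.smul_apply, smul_eq_mul]
  linear_combination s * (g i k * g j l - g i l * g j k) * hσ

theorem curvSymm_eps : CurvSymm eps :=
  ⟨eps_swap_fst, eps_swap_snd, eps_pair_comm⟩

theorem det_bivecMatrix_pull {U : MT} (hU : CurvSymm U) (N : Matrix (Fin 4) (Fin 4) ℝ) :
    (bivecMatrix (pull N U)).det = N.det ^ 6 * (bivecMatrix U).det := by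
  have h : bivecMatrix (pull N eps) = N.det • bivecMatrix eps := by
    ext I J
    exact pull_eps N _ _ _ _
  have h2 := congrArg Matrix.det h
  rw [bivecMatrix_pull curvSymm_eps, det_mul, det_mul, det_transpose, det_smul,
    det_bivecMatrix_eps, Fintype.card_sum, Fintype.card_fin] at h2
  rw [bivecMatrix_pull hU, det_mul, det_mul, det_transpose]
  linear_combination -(bivecMatrix U).det * h2

theorem det_bivecMatrix_normalT {s : ℝ} (hs : s ≠ 0) (t ρ : ℝ) (e b : Fin 3 → ℝ) :
    (bivecMatrix (normalT etaM s t ρ (bivec e b))).det =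
      -((s ^ 2 + t ^ 2) ^ 2 * (s ^ 2 + t ^ 2 + ρ * (s * ((b 0 ^ 2 + b 1 ^ 2 + b 2 ^ 2) -
        (e 0 ^ 2 + e 1 ^ 2 + e 2 ^ 2)) + 2 * t * (e 0 * b 0 + e 1 * b 1 + e 2 * b 2)))) := by
  set M : Matrix (Fin 3 ⊕ Fin 3) (Fin 3 ⊕ Fin 3) ℝ :=
    fromBlocks (diagonal fun _ => -s) (diagonal fun _ => t) (diagonal fun _ => t)
      (diagonal fun _ => s) with hM
  have hD : s ^ 2 + t ^ 2 ≠ 0 := by positivity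
  have hdet : M.det = -(s ^ 2 + t ^ 2) ^ 3 := by
    have h : M * fromBlocks 1 (diagonal fun _ => t) 0 (diagonal fun _ => s) =
        fromBlocks (diagonal fun _ => -s) 0 (diagonal fun _ => t)
          (diagonal fun _ => s ^ 2 + t ^ 2) := by
      rw [hM, fromBlocks_multiply]
      simp only [diagonal_mul_diagonal, diagonal_add, mul_one, mul_zero, add_zero]
      rw [← diagonal_zero]
      congr 2 <;> ext <;> ring
    have h2 := congrArg Matrix.det h
    rw [det_mul, det_fromBlocks_zero₂₁, det_fromBlocks_zero₁₂] at h2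
    simp only [det_one, det_diagonal, Finset.prod_const, Finset.card_univ, Fintype.card_fin] at h2
    exact mul_right_cancel₀ (pow_ne_zero 3 hs) (by linear_combination h2)
  have hmul : M * bivecMatrix (normalT etaM s t ρ (bivec e b)) = (s ^ 2 + t ^ 2) •
      (1 + replicateCol Unit ((ρ / (s ^ 2 + t ^ 2)) • (M *ᵥ Sum.elim e b)) *
        replicateRow Unit (Sum.elim e b)) := by
    have heta : etaM.IsSymm := isSymm_diagonal _
    rw [(curvSymm_normalT heta (bivec_antisymm e b) s t ρ).bivecMatrix_eq, hM,
      fromBlocks_multiply]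
    ext (i | i) (j | j) <;>
      simp [Matrix.mul_apply, blockX_normalT, blockY_normalT, blockZ_normalT,
        Matrix.one_apply, fromBlocks_mulVec, diagonal_apply, eq_comm (a := j)] <;>
      split_ifs <;> field_simp <;> ring
  have h := congrArg Matrix.det hmul
  rw [det_mul, hdet, det_smul, det_one_add_replicateCol_mul_replicateRow] at h
  simp only [hM, fromBlocks_mulVec, Fintype.card_sum, Fintype.card_fin, dotProduct,
    Fintype.sum_sum_type, Fin.sum_univ_three, Pi.smul_apply, Sum.elim_inl, Sum.elim_inr,
    smul_eq_mul, mulVec_diagonal, Pi.add_apply, Function.comp_apply] at h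
  refine mul_left_cancel₀ (neg_ne_zero.2 (pow_ne_zero 3 hD)) (h.trans ?_)
  field_simp
  ring

theorem sum_eps_mul_bivec (e b : Fin 3 → ℝ) :
    ∑ i, ∑ j, ∑ k, ∑ l, eps i j k l * (bivec e b i j * bivec e b k l) =
      8 * (e 0 * b 0 + e 1 * b 1 + e 2 * b 2) := by
  rw [sum_eps_mul fun i j k l => bivec e b i j * bivec e b k l]
  simp [bivec]
  ring

/-- The invariant of a bivector in terms of its components in a frame. -/
theorem traceT_tensAB_mul_det {N : Matrix (Fin 4) (Fin 4) ℝ} {A : BV} {e b : Fin 3 → ℝ}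
    (h : Nᵀ * Matrix.of A * N = bivec e b) (ρ : ℝ) :
    N.det * traceT (tensAB ρ A A) = 4 * ρ * (e 0 * b 0 + e 1 * b 1 + e 2 * b 2) := by
  have h1 := sum_eps_mul_pull N fun i j k l => A i j * A k l
  have h2 : pull N (fun i j k l => A i j * A k l) =
      fun i j k l => bivec e b i j * bivec e b k l := by
    ext i j k l
    simp only [← h, transpose_mul_mul_apply, pull, Finset.sum_mul, Finset.mul_sum, Matrix.of_apply]
    simp only [← Fintype.sum_prod_type']
    exact Fintype.sum_equiv ⟨fun x => (x.2.2.1, x.2.2.2, x.1, x.2.1),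
      fun x => (x.2.2.1, x.2.2.2, x.1, x.2.1), fun _ => rfl, fun _ => rfl⟩ _ _ fun _ => by
        simp; ring
  rw [h2, sum_eps_mul_bivec] at h1
  have h3 : traceT (tensAB ρ A A) =
      (1 / 2) * ρ * ∑ i, ∑ j, ∑ k, ∑ l, eps i j k l * (A i j * A k l) := by
    simp only [traceT, tensAB, Finset.mul_sum, Finset.sum_mul]
    exact Fintype.sum_congr _ _ fun a => Fintype.sum_congr _ _ fun b => Fintype.sum_congr _ _
      fun c => Fintype.sum_congr _ _ fun d => by ring
  rw [h3]
  linear_combination -(1 / 2) * ρ * h1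

/-- Main theorem, representation formula: a skewon-free invertible medium
tensor with a double light cone can be written as
κ = C₁·∗_g + ρ(Ā⊗A) + C₂·Id with C₁ ≠ 0, ρ ≠ 0, A ≠ 0, g Lorentz, and
det κ ≠ (C₁² + C₂²)²·(C₂ + (1/2)·tr(ρ Ā⊗A))². -/
theorem stmt16 (κ : MT) (hanti : antisymMT κ) (hskew : adjT κ = κ)
    (hinv : IsUnit (mat6 κ).det)
    (gp gm : Matrix (Fin 4) (Fin 4) ℝ) (hgp : IsLorentz gp) (hgm : IsLorentz gm)
    (hne : nullCone gp ≠ nullCone gm)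
    (hF : {ξ | fresnel κ ξ = 0} = nullCone gp ∪ nullCone gm) :
    ∃ (g : Matrix (Fin 4) (Fin 4) ℝ) (C₁ C₂ ρ : ℝ) (A : BV),
      IsLorentz g ∧ C₁ ≠ 0 ∧ ρ ≠ 0 ∧ antisymBV A ∧ A ≠ 0 ∧
      κ = (fun i j r s =>
        C₁ * hodge g i j r s + tensAB ρ A A i j r s + C₂ * idT i j r s) ∧
      (mat6 κ).det ≠
        (C₁ ^ 2 + C₂ ^ 2) ^ 2 * (C₂ + (1 / 2) * traceT (tensAB ρ A A)) ^ 2 := by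
  obtain ⟨P, σ, s, t, ρ, e, b, hP, hσ, hPg, hV, hs, hρ, heb, hinvar⟩ :=
    exists_frame_normal_form hanti hskew hgp hgm hne hF
  have hPu : IsUnit P.det := hP.isUnit
  set N := P⁻¹ with hN
  have hPN : P * N = 1 := Matrix.mul_nonsing_inv P hPu
  have hPN' : Pᵀ * Nᵀ = 1 := by
    rw [← Matrix.transpose_mul, Matrix.nonsing_inv_mul P hPu, Matrix.transpose_one]
  have hNP' : Nᵀ * Pᵀ = 1 := by rw [← Matrix.transpose_mul, hPN, Matrix.transpose_one]
  have hdet : P.det * N.det = 1 := by rw [← Matrix.det_mul, hPN, Matrix.det_one]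
  have hg : Nᵀ * (σ • etaM) * N = gp⁻¹ := by
    rw [← hPg, Matrix.mul_assoc, Matrix.mul_assoc _ P, hPN, Matrix.mul_one, ← Matrix.mul_assoc,
      hNP', Matrix.one_mul]
  have hgdet : |gp.det| = P.det ^ 2 := by
    have h := congrArg Matrix.det hPg
    have hg1 : gp⁻¹.det * gp.det = 1 := by
      rw [← Matrix.det_mul, Matrix.nonsing_inv_mul _ hgp.2.ne.isUnit, Matrix.det_one]
    rw [Matrix.det_mul, Matrix.det_mul, Matrix.det_transpose, Matrix.det_smul, etaM,
      Matrix.det_diagonal, Fintype.card_fin] at h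
    simp only [Fin.prod_univ_four, Matrix.cons_val] at h
    rw [abs_of_neg hgp.2]
    linear_combination -gp.det * h + P.det ^ 2 * hg1 + (σ ^ 2 + 1) * gp.det * hσ
  have hsqrt : Real.sqrt |gp.det| = |P.det| := by rw [hgdet, Real.sqrt_sq_eq_abs]
  set A : Matrix (Fin 4) (Fin 4) ℝ := Nᵀ * bivec e b * N with hA
  have hPA : Pᵀ * A * P = bivec e b := by
    have hNP : N * P = 1 := Matrix.nonsing_inv_mul P hPu
    rw [hA, Matrix.mul_assoc, Matrix.mul_assoc _ N, hNP, Matrix.mul_one, ← Matrix.mul_assoc,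
      hPN', Matrix.one_mul]
  have hraise : raise κ = normalT gp⁻¹ s (t * N.det) ρ A := by
    rw [← hg, ← pull_normalT, normalT_smul hσ, ← hV, ← pull_mul, hPN, pull_one]
  have htr := traceT_tensAB_mul_det (A := A) hPA (ρ / 4)
  have hdetκ : 64 * P.det ^ 6 * (mat6 κ).det = (s ^ 2 + t ^ 2) ^ 2 * (s ^ 2 + t ^ 2 +
      ρ * (s * ((b 0 ^ 2 + b 1 ^ 2 + b 2 ^ 2) - (e 0 ^ 2 + e 1 ^ 2 + e 2 ^ 2)) +
        2 * t * (e 0 * b 0 + e 1 * b 1 + e 2 * b 2))) := by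
    have h := det_bivecMatrix_pull (curvSymm_raise κ hanti hskew) P
    rw [hV, det_bivecMatrix_normalT hs, det_bivecMatrix_raise κ hanti] at h
    linear_combination h
  refine ⟨gp, s / (2 * |P.det|), t * N.det / 2, ρ / 4, A, hgp, by positivity, by positivity,
    ?_, ?_, ?_, ?_⟩
  · intro i j
    have h : Aᵀ = -A := by
      have hb : (bivec e b)ᵀ = -bivec e b := by
        ext i j
        exact bivec_antisymm e b j i
      rw [hA, Matrix.transpose_mul, Matrix.transpose_mul, hb, Matrix.transpose_transpose,
        ← Matrix.mul_assoc, Matrix.mul_neg, Matrix.neg_mul]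
    exact congrFun (congrFun h j) i
  · intro h
    refine heb ?_
    rw [← hPA, show A = 0 from h, Matrix.mul_zero, Matrix.zero_mul]
  · ext i j r u
    have h := sum_raise_mul_eps κ hanti i j r u
    rw [hraise, sum_normalT_mul_eps] at h
    simp only [hodge, tensAB, hsqrt]
    field_simp
    linear_combination -2 * h
  · intro h
    have hN0 : N.det = P.det⁻¹ := eq_inv_of_mul_eq_one_right hdet
    set T := traceT (tensAB (ρ / 4) A A) with hT
    have hC : s ^ 2 + t ^ 2 ≠ 0 := by positivity
    have hTe : T = ρ * (e 0 * b 0 + e 1 * b 1 + e 2 * b 2) / P.det := by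
      rw [eq_div_iff hP]
      linear_combination htr
    rw [hTe, hN0, div_pow, mul_pow, sq_abs] at h
    have h2 : 64 * P.det ^ 6 * (mat6 κ).det = (s ^ 2 + t ^ 2) ^ 2 *
        (t + ρ * (e 0 * b 0 + e 1 * b 1 + e 2 * b 2)) ^ 2 := by
      rw [h]
      field_simp
      ring
    exact hinvar (by linear_combination mul_left_cancel₀ (pow_ne_zero 2 hC) (hdetκ.symm.trans h2))
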